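/- Let I ≥ 1 and let ω : [0,∞) × ℝ² → ℝ be continuously differentiable and satisfy: for every t ≥ 0, ω(t,·) ∈ L¹(ℝ²) ∩ W^{1,∞}(ℝ²) is odd in x₂, ‖ω(t,·)‖_{L^∞} ≤ 1 and ‖ω(t,·)‖_{L¹} ≤ I; and ∂_t ω(t,x) + u(t,x)·∇_x ω(t,x) = 0 for all (t,x), where u(t,·) is the Biot–Savart velocity of ω(t,·). Then limsup_{t→∞} (ln ln max{‖∇_x ω(t,·)‖_{L^∞(ℝ²)}, e}) / t ≤ 2/π. -/

import Mathlib

open MeasureTheory Real Filter Set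
open scoped NNReal ENNReal

noncomputable section

/-- The Biot–Savart velocity of a vorticity `ω ∈ (L^∞ ∩ L¹)(ℝ²)`:
`u(x) = (1/(2π)) ∫_{ℝ²} ((x₂ − y₂, y₁ − x₁)/|x − y|²) ω(y) dy`. -/
def biotSavart (ω : ℝ × ℝ → ℝ) (x : ℝ × ℝ) : ℝ × ℝ :=
  ((1 / (2 * π)) * ∫ y : ℝ × ℝ, ((x.2 - y.2) / ((x.1 - y.1) ^ 2 + (x.2 - y.2) ^ 2)) * ω y,
   (1 / (2 * π)) * ∫ y : ℝ × ℝ, ((y.1 - x.1) / ((x.1 - y.1) ^ 2 + (x.2 - y.2) ^ 2)) * ω y)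

/-- `‖∇f‖_{L^∞(ℝ²)}` for a (Lipschitz, C¹) function `f : ℝ² → ℝ`. -/
def gradSup (f : ℝ × ℝ → ℝ) : ℝ :=
  ⨆ x : ℝ × ℝ, ‖fderiv ℝ f x‖

/-- The Euclidean norm on `ℝ × ℝ`. -/
def euclNorm (w : ℝ × ℝ) : ℝ := √(w.1 ^ 2 + w.2 ^ 2)

lemma euclNorm_nonneg (w : ℝ × ℝ) : 0 ≤ euclNorm w := Real.sqrt_nonneg _

lemma euclNorm_sq (w : ℝ × ℝ) : euclNorm w ^ 2 = w.1 ^ 2 + w.2 ^ 2 :=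
  Real.sq_sqrt (by positivity)

lemma continuous_euclNorm : Continuous euclNorm := by
  unfold euclNorm; fun_prop

@[fun_prop]
lemma measurable_euclNorm : Measurable euclNorm := continuous_euclNorm.measurable

lemma euclNorm_polar {r : ℝ} (hr : 0 < r) (θ : ℝ) : euclNorm (r * cos θ, r * sin θ) = r := by
  unfold euclNorm
  rw [show (r * cos θ) ^ 2 + (r * sin θ) ^ 2 = r ^ 2 by
    nlinarith [sin_sq_add_cos_sq θ], Real.sqrt_sq hr.le]

lemma integral_polar_mul {f : ℝ × ℝ → ℝ} {g A : ℝ → ℝ}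
    (hf : ∀ r, 0 < r → ∀ θ, f (r * cos θ, r * sin θ) = g r * A θ) :
    ∫ w, f w = (∫ r in Ioi (0 : ℝ), r * g r) * ∫ θ in Ioo (-π) π, A θ := by
  rw [← integral_comp_polarCoord_symm, polarCoord_target, ← setIntegral_prod_mul]
  refine setIntegral_congr_fun (measurableSet_Ioi.prod measurableSet_Ioo) fun p hp => ?_
  simp only [polarCoord_symm_apply, smul_eq_mul]
  rw [hf p.1 hp.1 p.2, mul_assoc]

lemma integral_radial (g : ℝ → ℝ) :
    ∫ w : ℝ × ℝ, g (euclNorm w) = (∫ r in Ioi (0 : ℝ), r * g r) * (2 * π) := by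
  rw [integral_polar_mul (g := g) (A := fun _ => 1)]
  · congr 1
    simp [Real.volume_real_Ioo_of_le (show -π ≤ π by linarith [pi_pos])]
    ring
  · intro r hr θ
    rw [euclNorm_polar hr, mul_one]

lemma integral_abs_cos_mul_sin : ∫ θ in Ioo (-π) π, |cos θ * sin θ| = 2 := by
  have hc : Continuous fun θ : ℝ => |cos θ * sin θ| := by fun_prop
  have hper : Function.Periodic (fun θ : ℝ => |cos θ * sin θ|) (π / 2) := by
    intro θ
    simp only [cos_add_pi_div_two, sin_add_pi_div_two]
    rw [← abs_neg]; congr 1; ring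
  have hbase : ∫ θ in (0 : ℝ)..(π / 2), |cos θ * sin θ| = 1 / 2 := by
    have h1 : ∫ θ in (0 : ℝ)..(π / 2), |cos θ * sin θ| = ∫ θ in (0 : ℝ)..(π / 2), sin θ * cos θ := by
      apply intervalIntegral.integral_congr
      intro θ hθ
      rw [uIcc_of_le (by positivity)] at hθ
      have h1 := cos_nonneg_of_mem_Icc ⟨by linarith [hθ.1, pi_pos], hθ.2⟩
      have h2 := sin_nonneg_of_nonneg_of_le_pi hθ.1 (by linarith [hθ.2, pi_pos])
      simp only
      rw [abs_of_nonneg (mul_nonneg h1 h2), mul_comm]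
    rw [h1, integral_sin_mul_cos₁]
    simp
  rw [← integral_Ioc_eq_integral_Ioo, ← intervalIntegral.integral_of_le (by linarith [pi_pos])]
  have h := hper.intervalIntegral_add_zsmul_eq 4 (-π) (fun _ _ => hc.intervalIntegrable _ _)
  have e : -π + (4 : ℤ) • (π / 2) = π := by simp; ring
  rw [e] at h
  rw [h, hper.intervalIntegral_add_eq (-π) 0, zero_add, hbase]
  simp; norm_num

lemma setIntegral_Ioi_ite_Ico {b c : ℝ} (hb : 0 < b) (hbc : b ≤ c) {g G : ℝ → ℝ}
    (hd : ∀ r, b ≤ r → HasDerivAt G (r * g r) r) (hc : ContinuousOn (fun r => r * g r) (Icc b c)) :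
    ∫ r in Ioi (0 : ℝ), r * (if b ≤ r ∧ r < c then g r else 0) = G c - G b := by
  have h1 : ∀ r, r * (if b ≤ r ∧ r < c then g r else 0)
      = (Ico b c).indicator (fun r => r * g r) r := by
    intro r
    by_cases h : b ≤ r ∧ r < c
    · simp [indicator, h]
    · rw [if_neg h, indicator_of_notMem (by simpa using h), mul_zero]
  simp_rw [h1]
  rw [setIntegral_indicator measurableSet_Ico,
    inter_eq_right.2 (show Ico b c ⊆ Ioi 0 from fun r hr => lt_of_lt_of_le hb hr.1), integral_Ico_eq_integral_Ioo,
    ← integral_Ioc_eq_integral_Ioo, ← intervalIntegral.integral_of_le hbc]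
  apply intervalIntegral.integral_eq_sub_of_hasDerivAt
  · intro r hr
    rw [uIcc_of_le hbc] at hr
    exact hd r hr.1
  · apply ContinuousOn.intervalIntegrable
    rwa [uIcc_of_le hbc]

lemma setIntegral_Ioi_ite_lt {R p : ℝ} (hR : 0 < R) (hp : 0 < p) :
    ∫ r in Ioi (0 : ℝ), r * (if r < R then r ^ (p - 2) else 0) = R ^ p / p := by
  have h1 : ∫ r in Ioi (0 : ℝ), r * (if r < R then r ^ (p - 2) else 0)
      = ∫ r in Ioi (0 : ℝ), (Iio R).indicator (fun r => r ^ (p - 1)) r := by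
    refine setIntegral_congr_fun measurableSet_Ioi fun r hr => ?_
    by_cases h : r < R
    · simp only [h, if_true, indicator, mem_Iio]
      nth_rewrite 1 [← Real.rpow_one r]
      rw [← Real.rpow_add hr]; congr 1; ring
    · simp [indicator, h]
  rw [h1, setIntegral_indicator measurableSet_Iio, Ioi_inter_Iio, ← integral_Ioc_eq_integral_Ioo,
    ← intervalIntegral.integral_of_le hR.le, integral_rpow (Or.inl (by linarith))]
  simp [Real.zero_rpow hp.ne']

/-- The kernel `1 / |v|` restricted to the disc of radius `b`. -/
def invNear (b : ℝ) (v : ℝ × ℝ) : ℝ := if euclNorm v < b then (euclNorm v) ^ ((1 : ℝ) - 2) else 0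

lemma invNear_nonneg (b : ℝ) (v : ℝ × ℝ) : 0 ≤ invNear b v := by
  unfold invNear
  split_ifs
  · exact Real.rpow_nonneg (euclNorm_nonneg v) _
  · rfl

lemma invNear_of_lt {b : ℝ} {v : ℝ × ℝ} (h : euclNorm v < b) : invNear b v = 1 / euclNorm v := by
  unfold invNear
  rw [if_pos h, show (1 : ℝ) - 2 = -1 by norm_num, Real.rpow_neg_one, one_div]

lemma integral_rpow_near {R p : ℝ} (hR : 0 < R) (hp : 0 < p) :
    ∫ v, (if euclNorm v < R then (euclNorm v) ^ (p - 2) else 0) = R ^ p / p * (2 * π) := by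
  rw [integral_radial (fun r => if r < R then r ^ (p - 2) else 0), setIntegral_Ioi_ite_lt hR hp]

lemma integrable_rpow_near {R p : ℝ} (hR : 0 < R) (hp : 0 < p) :
    Integrable fun v => if euclNorm v < R then (euclNorm v) ^ (p - 2) else 0 := by
  apply Integrable.of_integral_ne_zero
  rw [integral_rpow_near hR hp]
  have := Real.rpow_pos_of_pos hR p
  have := pi_pos
  positivity

lemma integral_invNear {b : ℝ} (hb : 0 < b) : ∫ v, invNear b v = 2 * π * b := by
  unfold invNear
  rw [integral_rpow_near hb one_pos, Real.rpow_one]; ring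

lemma integrable_invNear {b : ℝ} (hb : 0 < b) : Integrable (invNear b) :=
  integrable_rpow_near hb one_pos

lemma integral_inv_sq_annulus {R : ℝ} (hR : 0 < R) (hR1 : R < 1) :
    ∫ w, (if R ≤ euclNorm w ∧ euclNorm w < 1 then 1 / euclNorm w ^ 2 else 0)
      = log (1 / R) * (2 * π) := by
  rw [integral_radial (fun r => if R ≤ r ∧ r < 1 then 1 / r ^ 2 else 0)]
  rw [setIntegral_Ioi_ite_Ico (g := fun r => 1 / r ^ 2) (G := log) hR hR1.le]
  · simp
  · intro r hr
    have hr0 : r ≠ 0 := (hR.trans_le hr).ne'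
    convert Real.hasDerivAt_log hr0 using 1
    field_simp
  · apply ContinuousOn.mul continuousOn_id
    apply ContinuousOn.div continuousOn_const (by fun_prop)
    intro r hr
    have : r ≠ 0 := (hR.trans_le hr.1).ne'
    positivity

lemma integrable_inv_sq_annulus {R : ℝ} (hR : 0 < R) (hR1 : R < 1) :
    Integrable fun w => if R ≤ euclNorm w ∧ euclNorm w < 1 then 1 / euclNorm w ^ 2 else 0 := by
  apply Integrable.of_integral_ne_zero
  rw [integral_inv_sq_annulus hR hR1]
  have : 0 < log (1 / R) := Real.log_pos (by rw [lt_div_iff₀ hR]; linarith)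
  have := pi_pos
  positivity

/-- The dominating strain kernel on the annulus `b ≤ |w| < 1`. -/
def strainMid (a b : ℝ) (w : ℝ × ℝ) : ℝ :=
  (if b ≤ euclNorm w ∧ euclNorm w < 1 then 1 / euclNorm w ^ 4 + 4 * a ^ 2 / euclNorm w ^ 6 else 0)
    * |w.1 * w.2|

lemma integral_strainMid (a : ℝ) {b : ℝ} (hb : 0 < b) (hb1 : b < 1) :
    ∫ w, strainMid a b w = (log (1 / b) + 2 * a ^ 2 * (1 / b ^ 2 - 1)) * 2 := by
  unfold strainMid
  rw [integral_polar_mul (g := fun r => if b ≤ r ∧ r < 1 then 1 / r ^ 2 + 4 * a ^ 2 / r ^ 4 else 0)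
    (A := fun θ => |cos θ * sin θ|), integral_abs_cos_mul_sin]
  · rw [setIntegral_Ioi_ite_Ico (g := fun r => 1 / r ^ 2 + 4 * a ^ 2 / r ^ 4)
      (G := fun r => log r - 2 * a ^ 2 * (r ^ 2)⁻¹) hb hb1.le]
    · simp; ring
    · intro r hr
      have hr0 : r ≠ 0 := (hb.trans_le hr).ne'
      have h1 := (Real.hasDerivAt_log hr0).sub
        ((((hasDerivAt_id r).pow 2).inv (by simpa using hr0)).const_mul (2 * a ^ 2))
      refine h1.congr_deriv ?_
      simp
      field_simp
      ring
    · have hne : ∀ r ∈ Icc b 1, r ≠ 0 := fun r hr => (hb.trans_le hr.1).ne'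
      apply ContinuousOn.mul continuousOn_id
      apply ContinuousOn.add
      · exact ContinuousOn.div continuousOn_const (by fun_prop) fun r hr => pow_ne_zero _ (hne r hr)
      · exact ContinuousOn.div continuousOn_const (by fun_prop) fun r hr => pow_ne_zero _ (hne r hr)
  · intro r hr θ
    simp only [euclNorm_polar hr]
    rw [show r * cos θ * (r * sin θ) = r ^ 2 * (cos θ * sin θ) by ring, abs_mul,
      abs_of_pos (by positivity : (0 : ℝ) < r ^ 2)]
    split_ifs
    · field_simp
    · ring

lemma integrable_strainMid (a : ℝ) {b : ℝ} (hb : 0 < b) (hb1 : b < 1) :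
    Integrable (strainMid a b) := by
  apply Integrable.of_integral_ne_zero
  rw [integral_strainMid a hb hb1]
  have h1 : 0 < log (1 / b) := Real.log_pos (by rw [lt_div_iff₀ hb]; linarith)
  have h2 : 0 ≤ 1 / b ^ 2 - 1 := by
    rw [sub_nonneg, le_div_iff₀ (by positivity)]; nlinarith
  positivity

/-- The first component of the Biot–Savart difference quotient kernel for the two points
`(a, 0)` and `(-a, 0)`. -/
def strainKernel (a : ℝ) (w : ℝ × ℝ) : ℝ :=
  (1 / (2 * π)) * (w.2 / ((-a - w.1) ^ 2 + w.2 ^ 2) - w.2 / ((a - w.1) ^ 2 + w.2 ^ 2))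

@[fun_prop]
lemma measurable_strainKernel (a : ℝ) : Measurable (strainKernel a) := by
  unfold strainKernel
  fun_prop

lemma abs_div_sq_add_sq_le (x y : ℝ) : |y / (x ^ 2 + y ^ 2)| ≤ 1 / euclNorm (x, y) := by
  have h0 := euclNorm_nonneg (x, y)
  have h1 := euclNorm_sq (x, y)
  simp only at h1
  rw [← h1, abs_div, abs_of_nonneg (sq_nonneg (euclNorm (x, y)))]
  rcases h0.eq_or_lt with h | h
  · simp [← h]
  · rw [div_le_div_iff₀ (by positivity) h, one_mul, sq]
    refine mul_le_mul_of_nonneg_right ?_ h.le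
    apply abs_le_of_sq_le_sq _ h0
    rw [h1]; nlinarith [sq_nonneg x]

lemma abs_strainKernel_le (a : ℝ) (w : ℝ × ℝ) :
    |strainKernel a w| ≤
      (1 / (2 * π)) * (1 / euclNorm (w - (-a, 0)) + 1 / euclNorm (w - (a, 0))) := by
  have hp := pi_pos
  unfold strainKernel
  rw [abs_mul, abs_of_pos (by positivity : (0 : ℝ) < 1 / (2 * π))]
  refine mul_le_mul_of_nonneg_left ((abs_sub _ _).trans (add_le_add ?_ ?_)) (by positivity)
  · have := abs_div_sq_add_sq_le (w.1 - -a) w.2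
    rwa [show (-a - w.1) ^ 2 = (w.1 - -a) ^ 2 by ring,
      show w - (-a, 0) = (w.1 - -a, w.2) from Prod.ext rfl (sub_zero w.2)]
  · have := abs_div_sq_add_sq_le (w.1 - a) w.2
    rwa [show (a - w.1) ^ 2 = (w.1 - a) ^ 2 by ring,
      show w - (a, 0) = (w.1 - a, w.2) from Prod.ext rfl (sub_zero w.2)]

lemma abs_strainKernel_le_of_le {a : ℝ} (ha : 0 < a) {w : ℝ × ℝ} (hw : 2 * a ≤ euclNorm w) :
    |strainKernel a w| ≤
      (2 * a / π) * ((1 / euclNorm w ^ 4 + 4 * a ^ 2 / euclNorm w ^ 6) * |w.1 * w.2|) := by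
  have hp := pi_pos
  have hq := euclNorm_sq w
  set ρ := euclNorm w with hρ
  have hρ0 : 0 < ρ := by linarith
  have hqp : 4 * a ^ 2 ≤ ρ ^ 2 := by nlinarith
  have hsub : 0 < ρ ^ 2 - a ^ 2 := by nlinarith [sq_pos_of_pos ha]
  set N₁ := (-a - w.1) ^ 2 + w.2 ^ 2 with hN₁
  set N₂ := (a - w.1) ^ 2 + w.2 ^ 2 with hN₂
  have hN : (ρ ^ 2 - a ^ 2) ^ 2 ≤ N₁ * N₂ := by
    rw [hq]; simp only [hN₁, hN₂]
    nlinarith [mul_nonneg (sq_nonneg a) (sq_nonneg w.2)]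
  have hNpos : 0 < N₁ * N₂ := lt_of_lt_of_le (by positivity) hN
  have h1 : N₁ ≠ 0 := left_ne_zero_of_mul hNpos.ne'
  have h2 : N₂ ≠ 0 := right_ne_zero_of_mul hNpos.ne'
  have hk : strainKernel a w = (2 * a / π) * (-(w.1 * w.2) / (N₁ * N₂)) := by
    unfold strainKernel
    rw [← hN₁, ← hN₂]
    have : N₂ - N₁ = -(4 * a * w.1) := by simp only [hN₁, hN₂]; ring
    field_simp
    linear_combination w.2 * this
  rw [hk, abs_mul, abs_of_pos (by positivity : 0 < 2 * a / π)]
  refine mul_le_mul_of_nonneg_left ?_ (by positivity)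
  rw [abs_div, abs_neg, abs_of_pos hNpos, div_eq_mul_one_div, mul_comm]
  refine mul_le_mul_of_nonneg_right ?_ (abs_nonneg _)
  calc 1 / (N₁ * N₂) ≤ 1 / (ρ ^ 2 - a ^ 2) ^ 2 := one_div_le_one_div_of_le (by positivity) hN
    _ ≤ (ρ ^ 2 + 4 * a ^ 2) / ρ ^ 6 := by
      rw [div_le_div_iff₀ (by positivity) (by positivity)]
      nlinarith [mul_nonneg (sub_nonneg.2 hqp) (sq_nonneg a), mul_nonneg (sub_nonneg.2 hqp) (sq_nonneg ρ),
        mul_nonneg (sq_nonneg a) (mul_nonneg (sub_nonneg.2 hqp) (sq_nonneg ρ)),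
        mul_nonneg (sq_nonneg a) (mul_nonneg (sub_nonneg.2 hqp) (sub_nonneg.2 hqp)), pow_pos ha 6]
    _ = 1 / ρ ^ 4 + 4 * a ^ 2 / ρ ^ 6 := by field_simp

lemma abs_strainKernel_le_div_sq {a : ℝ} (ha : 0 < a) {w : ℝ × ℝ} (hw : 2 * a ≤ euclNorm w) :
    |strainKernel a w| ≤ a * (1 / euclNorm w ^ 2) := by
  refine (abs_strainKernel_le_of_le ha hw).trans ?_
  have hp := pi_gt_three
  have hq := euclNorm_sq w
  set ρ := euclNorm w with hρ
  have hρ0 : 0 < ρ := by linarith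
  have hqp : 4 * a ^ 2 ≤ ρ ^ 2 := by nlinarith
  have h1 : |w.1 * w.2| ≤ ρ ^ 2 / 2 := by
    rw [hq, abs_le]; constructor <;> nlinarith [sq_nonneg (w.1 - w.2), sq_nonneg (w.1 + w.2)]
  have h2 : 1 / ρ ^ 4 + 4 * a ^ 2 / ρ ^ 6 ≤ 2 / ρ ^ 4 := by
    have : 4 * a ^ 2 / ρ ^ 6 ≤ 1 / ρ ^ 4 := by
      rw [div_le_div_iff₀ (by positivity) (by positivity)]
      nlinarith [mul_le_mul_of_nonneg_right hqp (by positivity : 0 ≤ ρ ^ 4)]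
    have e : 2 / ρ ^ 4 = 1 / ρ ^ 4 + 1 / ρ ^ 4 := by ring
    linarith
  calc (2 * a / π) * ((1 / ρ ^ 4 + 4 * a ^ 2 / ρ ^ 6) * |w.1 * w.2|)
      ≤ (2 * a / π) * ((2 / ρ ^ 4) * (ρ ^ 2 / 2)) := by gcongr
    _ = (2 / π) * (a * (1 / ρ ^ 2)) := by field_simp
    _ ≤ 1 * (a * (1 / ρ ^ 2)) := by
      gcongr
      rw [div_le_one (by positivity)]; linarith
    _ = _ := one_mul _

lemma euclNorm_add_le (v w : ℝ × ℝ) : euclNorm (v + w) ≤ euclNorm v + euclNorm w := by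
  have hv := euclNorm_nonneg v
  have hw := euclNorm_nonneg w
  refine (Real.sqrt_le_left (by positivity)).2 ?_
  have h : v.1 * w.1 + v.2 * w.2 ≤ euclNorm v * euclNorm w := by
    refine le_trans (le_abs_self _) (abs_le_of_sq_le_sq ?_ (by positivity))
    rw [mul_pow, euclNorm_sq, euclNorm_sq]
    nlinarith [sq_nonneg (v.1 * w.2 - v.2 * w.1)]
  have e1 := euclNorm_sq v
  have e2 := euclNorm_sq w
  simp only [Prod.fst_add, Prod.snd_add]
  nlinarith

lemma euclNorm_mk_zero (a : ℝ) : euclNorm (a, 0) = |a| := by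
  simp [euclNorm, Real.sqrt_sq_eq_abs]

/-- Domination of `∫ strainKernel a * g`: the singular part near the two poles is controlled by
`|g| ≤ 2`, and the remaining part by the majorants `Q` and `a * h`. -/
lemma integrable_and_abs_integral_strainKernel_mul_le {a : ℝ} (ha : 0 < a) {g Q h : ℝ × ℝ → ℝ}
    (hg : AEStronglyMeasurable g) (hg2 : ∀ w, |g w| ≤ 2) (hQ : Integrable Q) (hh : Integrable h)
    (hQ0 : ∀ w, 0 ≤ Q w) (hh0 : ∀ w, 0 ≤ h w)
    (hdom : ∀ w, 2 * a ≤ euclNorm w → |strainKernel a w * g w| ≤ Q w + a * h w) :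
    Integrable (fun w => strainKernel a w * g w) ∧
      |∫ w, strainKernel a w * g w| ≤ 12 * a + (∫ w, Q w) + a * ∫ w, h w := by
  have hp := pi_pos
  have h3 : 0 < 3 * a := by positivity
  set n₁ : ℝ × ℝ → ℝ := fun w => invNear (3 * a) (w - (-a, 0)) with hn₁
  set n₂ : ℝ × ℝ → ℝ := fun w => invNear (3 * a) (w - (a, 0)) with hn₂
  have i₁ : Integrable n₁ := (integrable_invNear h3).comp_sub_right _
  have i₂ : Integrable n₂ := (integrable_invNear h3).comp_sub_right _
  have e₁ : ∫ w, n₁ w = 2 * π * (3 * a) := by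
    rw [← integral_invNear h3]; exact integral_sub_right_eq_self (invNear (3 * a)) _
  have e₂ : ∫ w, n₂ w = 2 * π * (3 * a) := by
    rw [← integral_invNear h3]; exact integral_sub_right_eq_self (invNear (3 * a)) _
  have hle : ∀ w, ‖strainKernel a w * g w‖ ≤ (1 / π) * (n₁ w + n₂ w) + Q w + a * h w := by
    intro w
    have hn0 : 0 ≤ n₁ w := invNear_nonneg _ _
    have hn0' : 0 ≤ n₂ w := invNear_nonneg _ _
    rw [Real.norm_eq_abs]
    by_cases hw : 2 * a ≤ euclNorm w
    · have : 0 ≤ (1 / π) * (n₁ w + n₂ w) := by positivity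
      linarith [hdom w hw]
    · push Not at hw
      have b₁ : euclNorm (w - (-a, 0)) < 3 * a := by
        have := euclNorm_add_le w (a, 0)
        rw [euclNorm_mk_zero, abs_of_pos ha] at this
        have e : w - (-a, 0) = w + (a, 0) := by ext <;> simp
        rw [e]; linarith
      have b₂ : euclNorm (w - (a, 0)) < 3 * a := by
        have := euclNorm_add_le w (-a, 0)
        rw [euclNorm_mk_zero, abs_neg, abs_of_pos ha] at this
        have e : w - (a, 0) = w + (-a, 0) := by ext <;> simp [sub_eq_add_neg]
        rw [e]; linarith
      have hk := abs_strainKernel_le a w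
      rw [← invNear_of_lt b₁, ← invNear_of_lt b₂] at hk
      have hk0 : 0 ≤ (1 / (2 * π)) * (n₁ w + n₂ w) := by positivity
      have := mul_le_mul hk (hg2 w) (abs_nonneg _) hk0
      rw [← abs_mul] at this
      have e : (1 / (2 * π)) * (n₁ w + n₂ w) * 2 = (1 / π) * (n₁ w + n₂ w) := by field_simp
      have := hQ0 w
      have := mul_nonneg ha.le (hh0 w)
      linarith
  have i₃ : Integrable fun w => (1 / π) * (n₁ w + n₂ w) := (i₁.add i₂).const_mul _
  have i₄ : Integrable fun w => (1 / π) * (n₁ w + n₂ w) + Q w := i₃.add hQ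
  have hint : Integrable fun w => (1 / π) * (n₁ w + n₂ w) + Q w + a * h w :=
    i₄.add (hh.const_mul a)
  refine ⟨hint.mono' ((measurable_strainKernel a).aestronglyMeasurable.mul hg)
    (Eventually.of_forall hle), ?_⟩
  have := norm_integral_le_of_norm_le hint (Eventually.of_forall hle)
  rw [integral_add i₄ (hh.const_mul a), integral_add i₃ hQ, integral_const_mul, integral_const_mul,
    integral_add i₁ i₂, e₁, e₂] at this
  rw [Real.norm_eq_abs] at this
  refine this.trans (le_of_eq ?_)
  field_simp
  ring

/-- The sharp logarithmic bound on the strain of a vorticity bounded by `1`. -/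
lemma abs_integral_strainKernel_mul_le_log {a I : ℝ} (ha : 0 < a) (ha1 : 2 * a < 1)
    {f : ℝ × ℝ → ℝ} (hf : Integrable f) (hf1 : ∀ w, |f w| ≤ 1) (hfI : ∫ w, |f w| ≤ I) :
    Integrable (fun w => strainKernel a w * f w) ∧
      |∫ w, strainKernel a w * f w| ≤ 2 * a * (2 / π * log (1 / (2 * a)) + (7 + I)) := by
  have hp := pi_gt_three
  have h2a : 0 < 2 * a := by positivity
  have hI : 0 ≤ I := le_trans (integral_nonneg fun _ => abs_nonneg _) hfI
  obtain ⟨h1, h2⟩ := integrable_and_abs_integral_strainKernel_mul_le (g := f)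
    (Q := fun w => (2 * a / π) * strainMid a (2 * a) w) (h := fun w => |f w|) ha
    hf.aestronglyMeasurable (fun w => (hf1 w).trans one_le_two)
    ((integrable_strainMid a h2a ha1).const_mul _) hf.abs
    (fun w => by
      unfold strainMid
      split_ifs <;> positivity)
    (fun _ => abs_nonneg _)
    (fun w hw => by
      rw [abs_mul]
      by_cases hw1 : euclNorm w < 1
      · have := abs_strainKernel_le_of_le ha hw
        unfold strainMid
        rw [if_pos ⟨hw, hw1⟩]
        have h3 := mul_le_mul_of_nonneg_left (hf1 w) (abs_nonneg (strainKernel a w))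
        have h4 := mul_nonneg ha.le (abs_nonneg (f w))
        linarith
      · push Not at hw1
        have h3 := abs_strainKernel_le_div_sq ha hw
        have h4 : 1 / euclNorm w ^ 2 ≤ 1 := by
          rw [div_le_one (by positivity)]; nlinarith
        have h5 : |strainKernel a w| ≤ a := by nlinarith
        have h6 := mul_le_mul_of_nonneg_right h5 (abs_nonneg (f w))
        unfold strainMid
        rw [if_neg (fun h => absurd h.2 (not_lt.2 hw1))]
        linarith)
  refine ⟨h1, h2.trans ?_⟩
  rw [integral_const_mul, integral_strainMid a h2a ha1]
  have e : 2 * a ^ 2 * (1 / (2 * a) ^ 2 - 1) ≤ 1 := by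
    have : 2 * a ^ 2 * (1 / (2 * a) ^ 2 - 1) = 1 / 2 - 2 * a ^ 2 := by field_simp
    rw [this]; nlinarith
  have e2 : 2 * a / π * ((log (1 / (2 * a)) + 2 * a ^ 2 * (1 / (2 * a) ^ 2 - 1)) * 2)
      ≤ 2 * a / π * ((log (1 / (2 * a)) + 1) * 2) := by gcongr
  have e3 : 2 * a / π * ((log (1 / (2 * a)) + 1) * 2)
      = 2 * a * (2 / π * log (1 / (2 * a))) + 2 * a * (2 / π) := by ring
  have e4 : 2 * a * (2 / π) ≤ 2 * a * 1 := by
    gcongr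
    rw [div_le_one (by positivity)]; linarith
  have e5 : a * ∫ w, |f w| ≤ a * I := by gcongr
  nlinarith

lemma integral_strainKernel_disc (a R : ℝ) :
    ∫ w, strainKernel a w * (if euclNorm w < R then 1 else 0) = 0 := by
  have hmp : MeasurePreserving (Prod.map id Neg.neg : ℝ × ℝ → ℝ × ℝ) :=
    (MeasurePreserving.id (volume : Measure ℝ)).prod (Measure.measurePreserving_neg volume)
  have hemb : MeasurableEmbedding (Prod.map id Neg.neg : ℝ × ℝ → ℝ × ℝ) :=
    ((Homeomorph.refl ℝ).prodCongr (Homeomorph.neg ℝ)).measurableEmbedding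
  have h := hmp.integral_comp hemb fun w => strainKernel a w * (if euclNorm w < R then 1 else 0)
  have h2 : ∀ w : ℝ × ℝ, strainKernel a (Prod.map id Neg.neg w) *
      (if euclNorm (Prod.map id Neg.neg w) < R then (1 : ℝ) else 0)
      = -(strainKernel a w * (if euclNorm w < R then 1 else 0)) := by
    intro w
    have e1 : euclNorm (Prod.map id Neg.neg w) = euclNorm w := by simp [euclNorm]
    have e2 : strainKernel a (Prod.map id Neg.neg w) = - strainKernel a w := by
      simp [strainKernel]; ring
    rw [e1, e2]; ring
  simp_rw [h2] at h
  rw [integral_neg] at h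
  linarith

/-- The strain bound for a Hölder continuous vorticity. -/
lemma abs_integral_strainKernel_mul_le_holder {a I R H α : ℝ} (ha : 0 < a) (haR : 2 * a < R)
    (hR1 : R < 1) (hα : 0 < α) (hH : 0 ≤ H)
    {f : ℝ × ℝ → ℝ} (hf : Integrable f) (hf1 : ∀ w, |f w| ≤ 1) (hfI : ∫ w, |f w| ≤ I)
    (hhol : ∀ w, |f w - f 0| ≤ H * euclNorm w ^ α) :
    |∫ w, strainKernel a w * f w|
      ≤ 2 * a * (π * (H * R ^ α / α) + π * log (1 / R) + (7 + I)) := by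
  have hp := pi_gt_three
  have hR : 0 < R := by linarith
  have hI : 0 ≤ I := le_trans (integral_nonneg fun _ => abs_nonneg _) hfI
  have hfi := (abs_integral_strainKernel_mul_le_log ha (haR.trans hR1) hf hf1 hfI).1
  have hmd : Measurable fun w => if euclNorm w < R then (1 : ℝ) else 0 :=
    Measurable.ite (measurableSet_lt measurable_euclNorm measurable_const) measurable_const
      measurable_const
  set g : ℝ × ℝ → ℝ := fun w => f w - f 0 * (if euclNorm w < R then 1 else 0) with hg
  have hgm : AEStronglyMeasurable g :=
    hf.aestronglyMeasurable.sub (hmd.aestronglyMeasurable.const_mul (f 0))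
  have hg2 : ∀ w, |g w| ≤ 2 := by
    intro w
    have h1 := abs_le.1 (hf1 w)
    have h2 := abs_le.1 (hf1 0)
    simp only [hg]
    rw [abs_le]
    split_ifs <;> constructor <;> linarith
  obtain ⟨hgi, hgb⟩ := integrable_and_abs_integral_strainKernel_mul_le (g := g)
    (Q := fun w => (a * H) * (if euclNorm w < R then euclNorm w ^ (α - 2) else 0)
      + a * (if R ≤ euclNorm w ∧ euclNorm w < 1 then 1 / euclNorm w ^ 2 else 0))
    (h := fun w => |f w|) ha hgm hg2
    (((integrable_rpow_near hR hα).const_mul _).add ((integrable_inv_sq_annulus hR hR1).const_mul _))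
    hf.abs
    (fun w => by
      have := Real.rpow_nonneg (euclNorm_nonneg w) (α - 2)
      split_ifs <;> positivity)
    (fun _ => abs_nonneg _)
    (fun w hw => by
      have h0 : 0 < euclNorm w := by linarith
      have h3 := abs_strainKernel_le_div_sq ha hw
      rw [abs_mul]
      have hfa := mul_nonneg ha.le (abs_nonneg (f w))
      by_cases hw1 : euclNorm w < R
      · rw [if_pos hw1, if_neg (fun h => absurd h.1 (not_le.2 hw1))]
        have h4 : |g w| ≤ H * euclNorm w ^ α := by
          simp only [hg, if_pos hw1, mul_one]; exact hhol w
        have h5 := mul_le_mul h3 h4 (abs_nonneg _) (by positivity)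
        have h6 : a * (1 / euclNorm w ^ 2) * (H * euclNorm w ^ α)
            = a * H * euclNorm w ^ (α - 2) := by
          rw [Real.rpow_sub h0, Real.rpow_two]; ring
        linarith
      · have hgw : g w = f w := by simp [hg, hw1]
        rw [hgw, if_neg hw1]
        push Not at hw1
        by_cases hw2 : euclNorm w < 1
        · rw [if_pos ⟨hw1, hw2⟩]
          have h5 := mul_le_mul_of_nonneg_left (hf1 w) (abs_nonneg (strainKernel a w))
          linarith
        · rw [if_neg (fun h => absurd h.2 hw2)]
          push Not at hw2
          have h4 : 1 / euclNorm w ^ 2 ≤ 1 := by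
            rw [div_le_one (by positivity)]; nlinarith
          have h5 : |strainKernel a w| ≤ a := by nlinarith
          have h6 := mul_le_mul_of_nonneg_right h5 (abs_nonneg (f w))
          linarith)
  have hdi : Integrable fun w => strainKernel a w * (f 0 * (if euclNorm w < R then 1 else 0)) := by
    refine (hfi.sub hgi).congr (Eventually.of_forall fun w => ?_)
    simp only [hg, Pi.sub_apply]
    ring
  have heq : ∫ w, strainKernel a w * f w = ∫ w, strainKernel a w * g w := by
    have h1 : ∀ w, strainKernel a w * g w = strainKernel a w * f w
        - strainKernel a w * (f 0 * (if euclNorm w < R then 1 else 0)) := by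
      intro w; simp only [hg]; ring
    simp_rw [h1]
    rw [integral_sub hfi hdi]
    have h2 : ∀ w, strainKernel a w * (f 0 * (if euclNorm w < R then 1 else 0))
        = f 0 * (strainKernel a w * (if euclNorm w < R then 1 else 0)) := fun w => by ring
    simp_rw [h2]
    rw [integral_const_mul, integral_strainKernel_disc, mul_zero, sub_zero]
  rw [heq]
  refine hgb.trans ?_
  rw [integral_add ((integrable_rpow_near hR hα).const_mul _)
    ((integrable_inv_sq_annulus hR hR1).const_mul _), integral_const_mul, integral_const_mul,
    integral_rpow_near hR hα, integral_inv_sq_annulus hR hR1]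
  have e5 : a * ∫ w, |f w| ≤ a * I := by gcongr
  have e6 : a * H * (R ^ α / α * (2 * π)) = 2 * a * (π * (H * R ^ α / α)) := by ring
  have e7 : a * (log (1 / R) * (2 * π)) = 2 * a * (π * log (1 / R)) := by ring
  rw [e6, e7]
  nlinarith

lemma abs_biotSavart_integrand_le {ω : ℝ × ℝ → ℝ} (hω1 : ∀ z, |ω z| ≤ 1) (x z : ℝ × ℝ) {k : ℝ}
    (hk : |k| ≤ 1 / euclNorm (z - x)) :
    ‖k * ω z‖ ≤ invNear 1 (z - x) + |ω z| := by
  rw [Real.norm_eq_abs, abs_mul]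
  have h0 := invNear_nonneg 1 (z - x)
  by_cases h : euclNorm (z - x) < 1
  · rw [← invNear_of_lt h] at hk
    have := mul_le_mul hk (hω1 z) (abs_nonneg _) h0
    linarith [abs_nonneg (ω z)]
  · push Not at h
    have h1 : 1 / euclNorm (z - x) ≤ 1 := by
      rw [div_le_one (by linarith)]; exact h
    have := mul_le_mul_of_nonneg_right (hk.trans h1) (abs_nonneg (ω z))
    linarith

lemma abs_biotSavart_kernel_fst_le (x z : ℝ × ℝ) :
    |(x.2 - z.2) / ((x.1 - z.1) ^ 2 + (x.2 - z.2) ^ 2)| ≤ 1 / euclNorm (z - x) := by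
  have h := abs_div_sq_add_sq_le (x.1 - z.1) (x.2 - z.2)
  have e : euclNorm (x.1 - z.1, x.2 - z.2) = euclNorm (z - x) := by
    unfold euclNorm; congr 1; simp only [Prod.fst_sub, Prod.snd_sub]; ring
  rwa [e] at h

lemma abs_biotSavart_kernel_snd_le (x z : ℝ × ℝ) :
    |(z.1 - x.1) / ((x.1 - z.1) ^ 2 + (x.2 - z.2) ^ 2)| ≤ 1 / euclNorm (z - x) := by
  have h := abs_div_sq_add_sq_le (x.2 - z.2) (z.1 - x.1)
  have e : euclNorm (x.2 - z.2, z.1 - x.1) = euclNorm (z - x) := by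
    unfold euclNorm; congr 1; simp only [Prod.fst_sub, Prod.snd_sub]; ring
  have e2 : (x.1 - z.1) ^ 2 + (x.2 - z.2) ^ 2 = (x.2 - z.2) ^ 2 + (z.1 - x.1) ^ 2 := by ring
  rwa [e, ← e2] at h

lemma integrable_invNear_sub_add_abs {ω : ℝ × ℝ → ℝ} (hω : Integrable ω) (x : ℝ × ℝ) :
    Integrable fun z => invNear 1 (z - x) + |ω z| :=
  ((integrable_invNear one_pos).comp_sub_right x).add hω.abs

lemma integrable_biotSavart_fst {ω : ℝ × ℝ → ℝ} (hω : Integrable ω) (hω1 : ∀ z, |ω z| ≤ 1)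
    (x : ℝ × ℝ) :
    Integrable fun z : ℝ × ℝ => ((x.2 - z.2) / ((x.1 - z.1) ^ 2 + (x.2 - z.2) ^ 2)) * ω z := by
  refine (integrable_invNear_sub_add_abs hω x).mono'
    (AEStronglyMeasurable.mul (Measurable.aestronglyMeasurable (by fun_prop))
      hω.aestronglyMeasurable) (Eventually.of_forall fun z => ?_)
  exact abs_biotSavart_integrand_le hω1 x z (abs_biotSavart_kernel_fst_le x z)

lemma integrable_biotSavart_snd {ω : ℝ × ℝ → ℝ} (hω : Integrable ω) (hω1 : ∀ z, |ω z| ≤ 1)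
    (x : ℝ × ℝ) :
    Integrable fun z : ℝ × ℝ => ((z.1 - x.1) / ((x.1 - z.1) ^ 2 + (x.2 - z.2) ^ 2)) * ω z := by
  refine (integrable_invNear_sub_add_abs hω x).mono'
    (AEStronglyMeasurable.mul (Measurable.aestronglyMeasurable (by fun_prop))
      hω.aestronglyMeasurable) (Eventually.of_forall fun z => ?_)
  exact abs_biotSavart_integrand_le hω1 x z (abs_biotSavart_kernel_snd_le x z)

lemma abs_biotSavart_component_le {ω : ℝ × ℝ → ℝ} {I : ℝ} (hω : Integrable ω)
    (hω1 : ∀ z, |ω z| ≤ 1) (hI : ∫ z, |ω z| ≤ I) (x : ℝ × ℝ) {k : ℝ × ℝ → ℝ}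
    (hk : ∀ z, |k z| ≤ 1 / euclNorm (z - x)) :
    |(1 / (2 * π)) * ∫ z, k z * ω z| ≤ 1 + I := by
  have hp := pi_gt_three
  have hI0 : 0 ≤ I := le_trans (integral_nonneg fun _ => abs_nonneg _) hI
  have h := norm_integral_le_of_norm_le (integrable_invNear_sub_add_abs hω x)
    (Eventually.of_forall fun z => abs_biotSavart_integrand_le hω1 x z (hk z))
  rw [integral_add ((integrable_invNear one_pos).comp_sub_right x) hω.abs,
    integral_sub_right_eq_self (invNear 1) x, integral_invNear one_pos, Real.norm_eq_abs] at h
  rw [abs_mul, abs_of_pos (by positivity), one_div, inv_mul_le_iff₀ (by positivity)]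
  nlinarith

lemma abs_biotSavart_le {ω : ℝ × ℝ → ℝ} {I : ℝ} (hω : Integrable ω)
    (hω1 : ∀ z, |ω z| ≤ 1) (hI : ∫ z, |ω z| ≤ I) (x : ℝ × ℝ) :
    |(biotSavart ω x).1| ≤ 1 + I ∧ |(biotSavart ω x).2| ≤ 1 + I :=
  ⟨abs_biotSavart_component_le hω hω1 hI x (abs_biotSavart_kernel_fst_le x),
    abs_biotSavart_component_le hω hω1 hI x (abs_biotSavart_kernel_snd_le x)⟩

/-- The rigid motion sending the origin to `m` and the first coordinate vector to `e`. -/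
def rigidMotion (m e w : ℝ × ℝ) : ℝ × ℝ :=
  (m.1 + (e.1 * w.1 + -e.2 * w.2), m.2 + (e.2 * w.1 + e.1 * w.2))

lemma measurePreserving_rigidMotion (m : ℝ × ℝ) {e : ℝ × ℝ} (he : e.1 ^ 2 + e.2 ^ 2 = 1) :
    MeasurePreserving (rigidMotion m e) := by
  set L := Matrix.toLin (.finTwoProd ℝ) (.finTwoProd ℝ) !![e.1, -e.2; e.2, e.1] with hL
  have hdet : LinearMap.det L = 1 := by
    rw [hL, LinearMap.det_toLin, Matrix.det_fin_two_of, ← he]; ring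
  have hmap := Measure.map_linearMap_addHaar_eq_smul_addHaar (volume : Measure (ℝ × ℝ))
    (f := L) (by rw [hdet]; exact one_ne_zero)
  rw [hdet, inv_one, abs_one, ENNReal.ofReal_one, one_smul] at hmap
  have hLm : MeasurePreserving L :=
    ⟨L.continuous_of_finiteDimensional.measurable, hmap⟩
  have h := (measurePreserving_add_left (volume : Measure (ℝ × ℝ)) m).comp hLm
  have hfun : rigidMotion m e = (fun x => m + x) ∘ L := by
    funext w
    refine Prod.ext ?_ ?_ <;> simp [rigidMotion, hL, Matrix.toLin_finTwoProd_apply]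
  rw [hfun]
  exact h

lemma measurableEmbedding_rigidMotion (m : ℝ × ℝ) {e : ℝ × ℝ} (he : e.1 ^ 2 + e.2 ^ 2 = 1) :
    MeasurableEmbedding (rigidMotion m e) := by
  refine Continuous.measurableEmbedding (by unfold rigidMotion; fun_prop) fun v w h => ?_
  have h1 := congrArg Prod.fst h
  have h2 := congrArg Prod.snd h
  simp only [rigidMotion] at h1 h2
  ext
  · linear_combination e.1 * h1 + e.2 * h2 - (v.1 - w.1) * he
  · linear_combination -e.2 * h1 + e.1 * h2 - (v.2 - w.2) * he

lemma euclNorm_rigidMotion_sub (m : ℝ × ℝ) {e : ℝ × ℝ} (he : e.1 ^ 2 + e.2 ^ 2 = 1)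
    (w : ℝ × ℝ) : euclNorm (rigidMotion m e w - rigidMotion m e 0) = euclNorm w := by
  unfold euclNorm rigidMotion
  congr 1
  simp only [Prod.fst_sub, Prod.snd_sub, Prod.fst_zero, Prod.snd_zero]
  linear_combination (w.1 ^ 2 + w.2 ^ 2) * he

lemma inner_biotSavart_eq {ω : ℝ × ℝ → ℝ} (hω : Integrable ω) (hω1 : ∀ z, |ω z| ≤ 1)
    (m : ℝ × ℝ) {e : ℝ × ℝ} (he : e.1 ^ 2 + e.2 ^ 2 = 1) (a : ℝ) :
    Integrable (fun w : ℝ × ℝ => (w.2 / ((a - w.1) ^ 2 + w.2 ^ 2)) * ω (rigidMotion m e w)) ∧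
    e.1 * (biotSavart ω (rigidMotion m e (a, 0))).1 + e.2 * (biotSavart ω (rigidMotion m e (a, 0))).2
      = -((1 / (2 * π)) *
          ∫ w : ℝ × ℝ, (w.2 / ((a - w.1) ^ 2 + w.2 ^ 2)) * ω (rigidMotion m e w)) := by
  set x := rigidMotion m e (a, 0) with hx
  have i1 := integrable_biotSavart_fst hω hω1 x
  have i2 := integrable_biotSavart_snd hω hω1 x
  have i3 := (i1.const_mul e.1).add (i2.const_mul e.2)
  have hmp := measurePreserving_rigidMotion m he
  have hemb := measurableEmbedding_rigidMotion m he
  have key : ∀ w, e.1 * ((x.2 - (rigidMotion m e w).2) / ((x.1 - (rigidMotion m e w).1) ^ 2 +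
      (x.2 - (rigidMotion m e w).2) ^ 2) * ω (rigidMotion m e w)) +
      e.2 * (((rigidMotion m e w).1 - x.1) / ((x.1 - (rigidMotion m e w).1) ^ 2 +
      (x.2 - (rigidMotion m e w).2) ^ 2) * ω (rigidMotion m e w)) =
      -((w.2 / ((a - w.1) ^ 2 + w.2 ^ 2)) * ω (rigidMotion m e w)) := by
    intro w
    have hD : (x.1 - (rigidMotion m e w).1) ^ 2 + (x.2 - (rigidMotion m e w).2) ^ 2
        = (a - w.1) ^ 2 + w.2 ^ 2 := by
      simp only [hx, rigidMotion]
      linear_combination ((a - w.1) ^ 2 + w.2 ^ 2) * he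
    have hn : e.1 * (x.2 - (rigidMotion m e w).2) + e.2 * ((rigidMotion m e w).1 - x.1)
        = -w.2 := by
      simp only [hx, rigidMotion]
      linear_combination (-w.2) * he
    rw [hD]
    linear_combination (ω (rigidMotion m e w) / ((a - w.1) ^ 2 + w.2 ^ 2)) * hn
  have hcomp := (hmp.integrable_comp_emb hemb).2 i3
  constructor
  · refine hcomp.neg.congr (Eventually.of_forall fun w => ?_)
    have := key w
    simp only [Pi.neg_apply, Function.comp_apply, Pi.add_apply]
    linarith
  · have h1 := hmp.integral_comp hemb fun z =>
      e.1 * (((x.2 - z.2) / ((x.1 - z.1) ^ 2 + (x.2 - z.2) ^ 2)) * ω z) +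
      e.2 * (((z.1 - x.1) / ((x.1 - z.1) ^ 2 + (x.2 - z.2) ^ 2)) * ω z)
    simp only [key] at h1
    rw [integral_add (i1.const_mul e.1) (i2.const_mul e.2), integral_const_mul,
      integral_const_mul, integral_neg] at h1
    unfold biotSavart
    simp only
    linear_combination (-(1 / (2 * π))) * h1

lemma inner_biotSavart_sub_eq {ω : ℝ × ℝ → ℝ} (hω : Integrable ω) (hω1 : ∀ z, |ω z| ≤ 1)
    (m : ℝ × ℝ) {e : ℝ × ℝ} (he : e.1 ^ 2 + e.2 ^ 2 = 1) (a : ℝ) :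
    e.1 * ((biotSavart ω (rigidMotion m e (a, 0))).1 - (biotSavart ω (rigidMotion m e (-a, 0))).1)
      + e.2 *
        ((biotSavart ω (rigidMotion m e (a, 0))).2 - (biotSavart ω (rigidMotion m e (-a, 0))).2)
      = ∫ w, strainKernel a w * ω (rigidMotion m e w) := by
  obtain ⟨i1, h1⟩ := inner_biotSavart_eq hω hω1 m he a
  obtain ⟨i2, h2⟩ := inner_biotSavart_eq hω hω1 m he (-a)
  have h3 : ∀ w, strainKernel a w * ω (rigidMotion m e w) =
      (1 / (2 * π)) * ((w.2 / ((-a - w.1) ^ 2 + w.2 ^ 2)) * ω (rigidMotion m e w)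
        - (w.2 / ((a - w.1) ^ 2 + w.2 ^ 2)) * ω (rigidMotion m e w)) := by
    intro w; unfold strainKernel; ring
  simp_rw [h3]
  rw [integral_const_mul, integral_sub i2 i1]
  linear_combination h1 - h2

/-- The longitudinal velocity increment `(x - y) · (u(x) - u(y))`. -/
def longIncr (ω : ℝ × ℝ → ℝ) (x y : ℝ × ℝ) : ℝ :=
  (x.1 - y.1) * ((biotSavart ω x).1 - (biotSavart ω y).1)
    + (x.2 - y.2) * ((biotSavart ω x).2 - (biotSavart ω y).2)

lemma exists_rigidMotion {x y : ℝ × ℝ} (hxy : 0 < euclNorm (x - y)) :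
    ∃ m e : ℝ × ℝ, e.1 ^ 2 + e.2 ^ 2 = 1 ∧ rigidMotion m e (euclNorm (x - y) / 2, 0) = x ∧
      rigidMotion m e (-(euclNorm (x - y) / 2), 0) = y ∧ x.1 - y.1 = euclNorm (x - y) * e.1 ∧
      x.2 - y.2 = euclNorm (x - y) * e.2 := by
  have hsq := euclNorm_sq (x - y)
  set r := euclNorm (x - y)
  simp only [Prod.fst_sub, Prod.snd_sub] at hsq
  refine ⟨((x.1 + y.1) / 2, (x.2 + y.2) / 2), ((x.1 - y.1) / r, (x.2 - y.2) / r), ?_, ?_, ?_, ?_, ?_⟩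
  · simp only
    rw [div_pow, div_pow, ← add_div, ← hsq, div_self (by positivity)]
  · unfold rigidMotion
    ext <;> simp only <;> field_simp <;> ring
  · unfold rigidMotion
    ext <;> simp only <;> field_simp <;> ring
  · field_simp
  · field_simp

lemma abs_longIncr_le_of_forall {ω : ℝ × ℝ → ℝ} {I : ℝ} (hω : Integrable ω)
    (hω1 : ∀ z, |ω z| ≤ 1) (hI : ∫ z, |ω z| ≤ I) {x y : ℝ × ℝ} (hxy : 0 < euclNorm (x - y))
    {B : ℝ}
    (hB : ∀ m e : ℝ × ℝ, e.1 ^ 2 + e.2 ^ 2 = 1 → Integrable (fun w => ω (rigidMotion m e w)) →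
      ∫ w, |ω (rigidMotion m e w)| ≤ I →
      |∫ w, strainKernel (euclNorm (x - y) / 2) w * ω (rigidMotion m e w)|
        ≤ euclNorm (x - y) * B) :
    |longIncr ω x y| ≤ euclNorm (x - y) ^ 2 * B := by
  obtain ⟨m, e, he, hx, hy, h1, h2⟩ := exists_rigidMotion hxy
  have h := inner_biotSavart_sub_eq hω hω1 m he (euclNorm (x - y) / 2)
  rw [hx, hy] at h
  have hmp := measurePreserving_rigidMotion m he
  have hemb := measurableEmbedding_rigidMotion m he
  have hb := hB m e he ((hmp.integrable_comp_emb hemb).2 hω)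
    ((hmp.integral_comp hemb fun z => |ω z|).trans_le hI)
  have e1 : longIncr ω x y = euclNorm (x - y) *
      ∫ w, strainKernel (euclNorm (x - y) / 2) w * ω (rigidMotion m e w) := by
    rw [← h]; unfold longIncr; rw [h1, h2]; ring
  rw [e1, abs_mul, abs_of_pos hxy, sq, mul_assoc]
  exact mul_le_mul_of_nonneg_left hb hxy.le

lemma abs_longIncr_le_log {ω : ℝ × ℝ → ℝ} {I : ℝ} (hω : Integrable ω)
    (hω1 : ∀ z, |ω z| ≤ 1) (hI : ∫ z, |ω z| ≤ I) {x y : ℝ × ℝ} (hxy : 0 < euclNorm (x - y))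
    (hxy1 : euclNorm (x - y) < 1) :
    |longIncr ω x y| ≤
      euclNorm (x - y) ^ 2 * (2 / π * log (1 / euclNorm (x - y)) + (7 + I)) := by
  refine abs_longIncr_le_of_forall hω hω1 hI hxy fun m e _ hint hI' => ?_
  have h := (abs_integral_strainKernel_mul_le_log (half_pos hxy) (by linarith) hint
    (fun w => hω1 _) hI').2
  rwa [mul_div_cancel₀ _ two_ne_zero] at h

lemma abs_longIncr_le_holder {ω : ℝ × ℝ → ℝ} {I R H α : ℝ} (hω : Integrable ω)
    (hω1 : ∀ z, |ω z| ≤ 1) (hI : ∫ z, |ω z| ≤ I) (hR1 : R < 1) (hα : 0 < α) (hH : 0 ≤ H)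
    (hhol : ∀ z z', |ω z - ω z'| ≤ H * euclNorm (z - z') ^ α)
    {x y : ℝ × ℝ} (hxy : 0 < euclNorm (x - y)) (hxyR : euclNorm (x - y) < R) :
    |longIncr ω x y| ≤
      euclNorm (x - y) ^ 2 * (π * (H * R ^ α / α) + π * log (1 / R) + (7 + I)) := by
  refine abs_longIncr_le_of_forall hω hω1 hI hxy fun m e he hint hI' => ?_
  have h := abs_integral_strainKernel_mul_le_holder (half_pos hxy) (by linarith) hR1 hα hH hint
    (fun w => hω1 _) hI' (fun w => by
      rw [← euclNorm_rigidMotion_sub m he w]; exact hhol _ _)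
  rwa [mul_div_cancel₀ _ two_ne_zero] at h

lemma hasDerivAt_transport {ω : ℝ → ℝ × ℝ → ℝ}
    (hC1 : ContDiffOn ℝ 1 (Function.uncurry ω) (Ici (0 : ℝ) ×ˢ (univ : Set (ℝ × ℝ))))
    {t : ℝ} (ht : 0 < t) (x u : ℝ × ℝ)
    (heq : derivWithin (fun τ => ω τ x) (Ici (0 : ℝ)) t
        + u.1 * fderiv ℝ (ω t) x (1, 0) + u.2 * fderiv ℝ (ω t) x (0, 1) = 0) :
    HasDerivAt (fun τ : ℝ => ω (t + τ) (x.1 + τ * u.1, x.2 + τ * u.2)) 0 0 := by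
  have hd : HasFDerivAt (Function.uncurry ω) (fderiv ℝ (Function.uncurry ω) (t, x)) (t, x) := by
    refine ((hC1.contDiffAt ?_).differentiableAt one_ne_zero).hasFDerivAt
    exact prod_mem_nhds (Ici_mem_nhds ht) univ_mem
  set L := fderiv ℝ (Function.uncurry ω) (t, x)
  have h1 : HasDerivAt (fun τ => ω τ x) (L (1, 0)) t :=
    HasFDerivAt.comp_hasDerivAt (f := fun τ : ℝ => (τ, x)) t hd
      ((hasDerivAt_id t).prodMk (hasDerivAt_const t x))
  have h2 : HasFDerivAt (ω t) (L.comp ((0 : ℝ × ℝ →L[ℝ] ℝ).prod (.id ℝ (ℝ × ℝ)))) x :=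
    HasFDerivAt.comp (f := fun z : ℝ × ℝ => (t, z)) x hd
      ((hasFDerivAt_const t x).prodMk (hasFDerivAt_id x))
  rw [(h1.hasDerivWithinAt).derivWithin (uniqueDiffOn_Ici 0 t ht.le), h2.fderiv] at heq
  have hc : HasDerivAt (fun τ : ℝ => (t + τ, ((x.1 + τ * u.1, x.2 + τ * u.2) : ℝ × ℝ)))
      (1, (u.1, u.2)) 0 := by
    refine HasDerivAt.prodMk ?_ (HasDerivAt.prodMk ?_ ?_)
    · simpa using (hasDerivAt_id (0 : ℝ)).const_add t
    · simpa using ((hasDerivAt_id (0 : ℝ)).mul_const u.1).const_add x.1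
    · simpa using ((hasDerivAt_id (0 : ℝ)).mul_const u.2).const_add x.2
  have hd' : HasFDerivAt (Function.uncurry ω) L
      (t + 0, ((x.1 + 0 * u.1, x.2 + 0 * u.2) : ℝ × ℝ)) := by simpa using hd
  have h3 := HasFDerivAt.comp_hasDerivAt (0 : ℝ) hd' hc
  have h4 : L (1, (u.1, u.2)) = 0 := by
    rw [← heq]
    have : ((1, (u.1, u.2)) : ℝ × ℝ × ℝ) = (1, 0) + (u.1 • (0, (1, 0)) + u.2 • (0, (0, 1))) := by
      simp
    rw [this, map_add, map_add, map_smul, map_smul]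
    simp [add_assoc]
  rw [h4] at h3
  exact h3

lemma hasDerivAt_nonneg_of_forall_le {f : ℝ → ℝ} {f' δ : ℝ} (hδ : 0 < δ)
    (hf : HasDerivAt f f' 0) (hmax : ∀ τ, -δ ≤ τ → τ ≤ 0 → f τ ≤ f 0) : 0 ≤ f' := by
  have h := (hasDerivAt_iff_tendsto_slope.1 hf).mono_left
    (nhdsWithin_mono (s := Iio 0) 0 (fun τ (h : τ < 0) => ne_of_lt h))
  refine ge_of_tendsto h ?_
  filter_upwards [Ioo_mem_nhdsLT (neg_lt_zero.2 hδ)] with τ hτ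
  rw [slope_def_field]
  exact div_nonneg_of_nonpos (sub_nonpos.2 (hmax τ hτ.1.le hτ.2.le)) (by linarith [hτ.2])

/-- A supersolution of the two-point transport equation dominates the increments of `ω`. -/
theorem increment_le_of_supersolution {ω : ℝ → ℝ × ℝ → ℝ} {M : ℝ}
    (hC1 : ContDiffOn ℝ 1 (Function.uncurry ω) (Ici (0 : ℝ) ×ˢ (univ : Set (ℝ × ℝ))))
    (hω1 : ∀ t, 0 ≤ t → ∀ x, |ω t x| ≤ 1)
    (hu : ∀ t, 0 ≤ t → ∀ x, |(biotSavart (ω t) x).1| ≤ M ∧ |(biotSavart (ω t) x).2| ≤ M)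
    (heq : ∀ t : ℝ, 0 ≤ t → ∀ x : ℝ × ℝ,
      derivWithin (fun τ => ω τ x) (Ici (0 : ℝ)) t
        + (biotSavart (ω t) x).1 * fderiv ℝ (ω t) x (1, 0)
        + (biotSavart (ω t) x).2 * fderiv ℝ (ω t) x (0, 1) = 0)
    {F : ℝ → ℝ → ℝ}
    (hFc : ContinuousOn (Function.uncurry F) (Ici (0 : ℝ) ×ˢ Ici (0 : ℝ)))
    (hF0 : ∀ t s, 0 ≤ t → 0 ≤ s → 0 ≤ F t s)
    (hF2 : ∀ t s, 0 ≤ t → 1 ≤ s → 2 ≤ F t s)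
    (hFi : ∀ x y, ω 0 x - ω 0 y ≤ F 0 (euclNorm (x - y) ^ 2))
    (hFs : ∀ t, 0 < t → ∀ x y, 0 < euclNorm (x - y) → euclNorm (x - y) < 1 → ∀ σ : ℝ → ℝ,
      σ 0 = euclNorm (x - y) ^ 2 → HasDerivAt σ (2 * longIncr (ω t) x y) 0 →
      ∃ d, 0 ≤ d ∧ HasDerivAt (fun τ => F (t + τ) (σ τ)) d 0)
    {t : ℝ} (ht : 0 ≤ t) (x y : ℝ × ℝ) :
    ω t x - ω t y ≤ F t (euclNorm (x - y) ^ 2) := by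
  by_contra! hcon
  have hM : 0 ≤ M := (abs_nonneg _).trans (hu 0 le_rfl 0).1
  set k : ℝ := 4 * M + 1 with hk
  let N : (ℝ × ℝ) × (ℝ × ℝ) → ℝ := fun q => 1 + q.1.1 ^ 2 + q.1.2 ^ 2 + q.2.1 ^ 2 + q.2.2 ^ 2
  have hN1 : ∀ q, 1 ≤ N q := fun q => by
    simp only [N]; nlinarith [sq_nonneg q.1.1, sq_nonneg q.1.2, sq_nonneg q.2.1, sq_nonneg q.2.2]
  let G : ℝ × (ℝ × ℝ) × (ℝ × ℝ) → ℝ := fun p =>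
    ω p.1 p.2.1 - ω p.1 p.2.2 - F p.1 (euclNorm (p.2.1 - p.2.2) ^ 2)
  have hG0 : 0 < G (t, x, y) := by simp only [G]; linarith
  have hw : 0 < exp (k * t) * N (x, y) := by have := hN1 (x, y); positivity
  set ε : ℝ := G (t, x, y) / (2 * (exp (k * t) * N (x, y))) with hε
  have hεpos : 0 < ε := by positivity
  let Ψ : ℝ × (ℝ × ℝ) × (ℝ × ℝ) → ℝ := fun p => G p - ε * (exp (k * p.1) * N p.2)
  have hΨ0 : 0 < Ψ (t, x, y) := by
    have : ε * (exp (k * t) * N (x, y)) = G (t, x, y) / 2 := by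
      rw [hε, div_mul_eq_mul_div, div_eq_div_iff (by positivity) two_ne_zero]; ring
    simp only [Ψ]; linarith
  let ρ : ℝ := √(2 / ε)
  let K : Set (ℝ × (ℝ × ℝ) × (ℝ × ℝ)) :=
    Icc 0 t ×ˢ (Icc (-ρ) ρ ×ˢ Icc (-ρ) ρ) ×ˢ (Icc (-ρ) ρ ×ˢ Icc (-ρ) ρ)
  have hKc : IsCompact K :=
    isCompact_Icc.prod ((isCompact_Icc.prod isCompact_Icc).prod (isCompact_Icc.prod isCompact_Icc))
  have hmem : ∀ p : ℝ × (ℝ × ℝ) × (ℝ × ℝ), 0 ≤ p.1 → p.1 ≤ t → 0 < Ψ p → p ∈ K := by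
    rintro ⟨τ, ⟨a, b⟩, ⟨c, d⟩⟩ h0 h1 hp
    simp only [Ψ, G] at hp h0 h1
    have g1 := abs_le.1 (hω1 τ h0 (a, b))
    have g2 := abs_le.1 (hω1 τ h0 (c, d))
    have g3 := hF0 τ (euclNorm ((a, b) - (c, d)) ^ 2) h0 (sq_nonneg _)
    have g4 : 1 ≤ exp (k * τ) := one_le_exp (by positivity)
    have g5 := hN1 ((a, b), (c, d))
    have g6 : ε * N ((a, b), (c, d)) < 2 := by
      have : N ((a, b), (c, d)) ≤ exp (k * τ) * N ((a, b), (c, d)) := by nlinarith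
      have := mul_le_mul_of_nonneg_left this hεpos.le
      linarith
    have g7 : N ((a, b), (c, d)) ≤ 2 / ε := by
      rw [le_div_iff₀ hεpos]; linarith
    simp only [N] at g7
    have hroot : ∀ z : ℝ, z ^ 2 ≤ 2 / ε → z ∈ Icc (-ρ) ρ := fun z hz =>
      abs_le.1 (Real.abs_le_sqrt hz)
    have := sq_nonneg a; have := sq_nonneg b; have := sq_nonneg c; have := sq_nonneg d
    exact ⟨⟨h0, h1⟩, ⟨hroot a (by linarith), hroot b (by linarith)⟩,
      ⟨hroot c (by linarith), hroot d (by linarith)⟩⟩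
  have hΨc : ContinuousOn Ψ K := by
    have c1 : ContinuousOn (fun p : ℝ × (ℝ × ℝ) × (ℝ × ℝ) => ω p.1 p.2.1) K :=
      hC1.continuousOn.comp (f := fun p : ℝ × (ℝ × ℝ) × (ℝ × ℝ) => (p.1, p.2.1)) (by fun_prop)
        fun p hp => ⟨hp.1.1, mem_univ _⟩
    have c2 : ContinuousOn (fun p : ℝ × (ℝ × ℝ) × (ℝ × ℝ) => ω p.1 p.2.2) K :=
      hC1.continuousOn.comp (f := fun p : ℝ × (ℝ × ℝ) × (ℝ × ℝ) => (p.1, p.2.2)) (by fun_prop)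
        fun p hp => ⟨hp.1.1, mem_univ _⟩
    have he := continuous_euclNorm
    have c3 : ContinuousOn
        (fun p : ℝ × (ℝ × ℝ) × (ℝ × ℝ) => F p.1 (euclNorm (p.2.1 - p.2.2) ^ 2)) K :=
      hFc.comp
        (f := fun p : ℝ × (ℝ × ℝ) × (ℝ × ℝ) => (p.1, euclNorm (p.2.1 - p.2.2) ^ 2)) (by fun_prop)
        fun p hp => ⟨hp.1.1, sq_nonneg (euclNorm (p.2.1 - p.2.2))⟩
    exact ((c1.sub c2).sub c3).sub (by simp only [N]; fun_prop)
  obtain ⟨⟨T, X, Y⟩, hpK, hpmax⟩ :=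
    hKc.exists_isMaxOn ⟨_, hmem (t, x, y) ht le_rfl hΨ0⟩ hΨc
  have hpos : 0 < Ψ (T, X, Y) := hΨ0.trans_le (hpmax (hmem (t, x, y) ht le_rfl hΨ0))
  have hmax : ∀ p : ℝ × (ℝ × ℝ) × (ℝ × ℝ), 0 ≤ p.1 → p.1 ≤ t → Ψ p ≤ Ψ (T, X, Y) := by
    intro p h0 h1
    by_cases h : 0 < Ψ p
    · exact hpmax (hmem p h0 h1 h)
    · push Not at h; linarith
  have hT0 : 0 ≤ T := hpK.1.1
  have hTt : T ≤ t := hpK.1.2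
  have hNpos : 0 < exp (k * T) * N (X, Y) := by have := hN1 (X, Y); positivity
  have hpen : 0 < ε * (exp (k * T) * N (X, Y)) := mul_pos hεpos hNpos
  have hGpos : 0 < G (T, X, Y) := by simp only [Ψ] at hpos; linarith
  have hTpos : 0 < T := by
    rcases hT0.eq_or_lt with h | h
    · subst h
      have := hFi X Y
      simp only [G] at hGpos; linarith
    · exact h
  have hr0 : 0 < euclNorm (X - Y) := by
    rcases (euclNorm_nonneg (X - Y)).eq_or_lt with h | h
    · have h2 := euclNorm_sq (X - Y)
      rw [← h] at h2
      simp only [Prod.fst_sub, Prod.snd_sub] at h2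
      have e1 : X.1 - Y.1 = 0 := by nlinarith [sq_nonneg (X.1 - Y.1), sq_nonneg (X.2 - Y.2)]
      have e2 : X.2 - Y.2 = 0 := by nlinarith [sq_nonneg (X.1 - Y.1), sq_nonneg (X.2 - Y.2)]
      have e3 : X = Y := Prod.ext (by linarith) (by linarith)
      have := hF0 T (euclNorm (X - Y) ^ 2) hT0 (sq_nonneg _)
      simp only [G] at hGpos
      rw [e3] at hGpos this
      linarith
    · exact h
  have hr1 : euclNorm (X - Y) < 1 := by
    by_contra! h
    have := hF2 T (euclNorm (X - Y) ^ 2) hT0 (one_le_pow₀ h)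
    have g1 := abs_le.1 (hω1 T hT0 X)
    have g2 := abs_le.1 (hω1 T hT0 Y)
    simp only [G] at hGpos; linarith
  set u := biotSavart (ω T) X with hudef
  set v := biotSavart (ω T) Y with hvdef
  have dX := hasDerivAt_transport hC1 hTpos X u (heq T hT0 X)
  have dY := hasDerivAt_transport hC1 hTpos Y v (heq T hT0 Y)
  have lin : ∀ a b : ℝ, HasDerivAt (fun τ : ℝ => a + τ * b) b 0 := fun a b => by
    simpa using ((hasDerivAt_id (0 : ℝ)).mul_const b).const_add a
  let σ : ℝ → ℝ := fun τ =>
    euclNorm ((X.1 + τ * u.1, X.2 + τ * u.2) - (Y.1 + τ * v.1, Y.2 + τ * v.2)) ^ 2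
  have dσ : HasDerivAt σ (2 * longIncr (ω T) X Y) 0 := by
    have h := (((lin X.1 u.1).sub (lin Y.1 v.1)).pow 2).add
      (((lin X.2 u.2).sub (lin Y.2 v.2)).pow 2)
    refine HasDerivAt.congr_deriv (h.congr_of_eventuallyEq (Eventually.of_forall fun τ => ?_)) ?_
    · simp only [σ, euclNorm_sq, Prod.fst_sub, Prod.snd_sub, Pi.add_apply, Pi.pow_apply,
        Pi.sub_apply]
    · simp only [longIncr, Pi.sub_apply, ← hudef, ← hvdef]
      simp
      ring
  obtain ⟨d, hd0, dF⟩ := hFs T hTpos X Y hr0 hr1 σ (by simp [σ]; rfl) dσ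
  have dexp : HasDerivAt (fun τ : ℝ => exp (k * (T + τ))) (exp (k * T) * k) 0 := by
    have h := (((hasDerivAt_id (0 : ℝ)).const_add T).const_mul k).exp
    simpa using h
  have dN : HasDerivAt (fun τ : ℝ =>
      N ((X.1 + τ * u.1, X.2 + τ * u.2), (Y.1 + τ * v.1, Y.2 + τ * v.2)))
      (2 * (X.1 * u.1 + X.2 * u.2 + Y.1 * v.1 + Y.2 * v.2)) 0 := by
    have h := (((((lin X.1 u.1).pow 2).const_add 1).add ((lin X.2 u.2).pow 2)).add
      ((lin Y.1 v.1).pow 2)).add ((lin Y.2 v.2).pow 2)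
    refine HasDerivAt.congr_deriv (h.congr_of_eventuallyEq (Eventually.of_forall fun τ => ?_)) ?_
    · simp [N]
    · simp
      ring
  have dΨ := ((dX.sub dY).sub dF).sub ((dexp.mul dN).const_mul ε)
  have hneg := hasDerivAt_nonneg_of_forall_le hTpos dΨ (fun τ h1 h2 => by
    have := hmax (T + τ, (X.1 + τ * u.1, X.2 + τ * u.2), (Y.1 + τ * v.1, Y.2 + τ * v.2))
      (by simp only; linarith) (by simp only; linarith)
    simpa only [Ψ, G, σ, Pi.sub_apply, Pi.mul_apply, zero_mul, add_zero, Prod.mk.eta] using this)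
  simp only [zero_mul, add_zero, sub_self, zero_sub] at hneg
  have bnd : ∀ a b : ℝ, |b| ≤ M → -(M * (1 + a ^ 2)) ≤ 2 * (a * b) := by
    intro a b hb
    have hb' := abs_le.1 hb
    rcases le_total 0 a with ha | ha
    · linarith [mul_nonneg hM (sq_nonneg (a - 1)), mul_le_mul_of_nonneg_left hb'.1 ha]
    · linarith [mul_nonneg hM (sq_nonneg (a + 1)), mul_le_mul_of_nonpos_left hb'.2 ha]
  have b1 := bnd X.1 u.1 (hu T hT0 X).1
  have b2 := bnd X.2 u.2 (hu T hT0 X).2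
  have b3 := bnd Y.1 v.1 (hu T hT0 Y).1
  have b4 := bnd Y.2 v.2 (hu T hT0 Y).2
  have hN1' := hN1 (X, Y)
  have key : 0 < k * N (X, Y) + 2 * (X.1 * u.1 + X.2 * u.2 + Y.1 * v.1 + Y.2 * v.2) := by
    simp only [N] at hN1' ⊢
    rw [hk]
    linarith [mul_nonneg hM (sq_nonneg X.1), mul_nonneg hM (sq_nonneg X.2),
      mul_nonneg hM (sq_nonneg Y.1), mul_nonneg hM (sq_nonneg Y.2)]
  have key2 := mul_pos hεpos (mul_pos (exp_pos (k * T)) key)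
  simp only [Prod.mk.eta] at hneg
  linarith

/-- A bounded integrable `C¹` solution of the transport equation with Biot–Savart velocity. -/
structure IsEulerSolution (I : ℝ) (ω : ℝ → ℝ × ℝ → ℝ) : Prop where
  contDiffOn : ContDiffOn ℝ 1 (Function.uncurry ω) (Ici (0 : ℝ) ×ˢ (univ : Set (ℝ × ℝ)))
  integrable : ∀ t, 0 ≤ t → Integrable (ω t)
  abs_le_one : ∀ t, 0 ≤ t → ∀ x, |ω t x| ≤ 1
  integral_abs_le : ∀ t, 0 ≤ t → ∫ y, |ω t y| ≤ I
  transport : ∀ t : ℝ, 0 ≤ t → ∀ x : ℝ × ℝ,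
    derivWithin (fun τ => ω τ x) (Ici (0 : ℝ)) t
      + (biotSavart (ω t) x).1 * fderiv ℝ (ω t) x (1, 0)
      + (biotSavart (ω t) x).2 * fderiv ℝ (ω t) x (0, 1) = 0

lemma euclNorm_sub_comm (x y : ℝ × ℝ) : euclNorm (x - y) = euclNorm (y - x) := by
  unfold euclNorm; congr 1; simp only [Prod.fst_sub, Prod.snd_sub]; ring

lemma IsEulerSolution.abs_increment_le {I : ℝ} {ω : ℝ → ℝ × ℝ → ℝ} (h : IsEulerSolution I ω)
    {F : ℝ → ℝ → ℝ}
    (hFc : ContinuousOn (Function.uncurry F) (Ici (0 : ℝ) ×ˢ Ici (0 : ℝ)))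
    (hF0 : ∀ t s, 0 ≤ t → 0 ≤ s → 0 ≤ F t s)
    (hF2 : ∀ t s, 0 ≤ t → 1 ≤ s → 2 ≤ F t s)
    (hFi : ∀ x y, ω 0 x - ω 0 y ≤ F 0 (euclNorm (x - y) ^ 2))
    (hFs : ∀ t, 0 < t → ∀ x y, 0 < euclNorm (x - y) → euclNorm (x - y) < 1 → ∀ σ : ℝ → ℝ,
      σ 0 = euclNorm (x - y) ^ 2 → HasDerivAt σ (2 * longIncr (ω t) x y) 0 →
      ∃ d, 0 ≤ d ∧ HasDerivAt (fun τ => F (t + τ) (σ τ)) d 0)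
    {t : ℝ} (ht : 0 ≤ t) (x y : ℝ × ℝ) :
    |ω t x - ω t y| ≤ F t (euclNorm (x - y) ^ 2) := by
  have key := fun x y => increment_le_of_supersolution h.contDiffOn h.abs_le_one
    (fun t ht => abs_biotSavart_le (h.integrable t ht) (h.abs_le_one t ht)
      (h.integral_abs_le t ht)) h.transport hFc hF0 hF2 hFi hFs ht x y
  refine abs_le.2 ⟨?_, key x y⟩
  have := key y x
  rw [euclNorm_sub_comm] at this
  linarith

/-- Propagation of Hölder regularity with an exponentially decaying exponent. -/
theorem IsEulerSolution.holder {I : ℝ} {ω : ℝ → ℝ × ℝ → ℝ} (h : IsEulerSolution I ω)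
    (hI : 0 ≤ I) {A : ℝ} (hA : 2 ≤ A) (hA' : ∀ x y, |ω 0 x - ω 0 y| ≤ A * euclNorm (x - y))
    {t : ℝ} (ht : 0 ≤ t) (x y : ℝ × ℝ) :
    |ω t x - ω t y| ≤ A * exp ((7 + I) * t) * euclNorm (x - y) ^ exp (-(2 / π * t)) := by
  have hc : 0 < 2 / π := by positivity
  have h1 := h.abs_increment_le
    (F := fun t s => A * exp ((7 + I) * t) * s ^ (exp (-(2 / π * t)) / 2)) ?_ ?_ ?_ ?_ ?_ ht x y
  · rwa [← rpow_natCast, ← rpow_mul (euclNorm_nonneg _), Nat.cast_two,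
      mul_div_cancel₀ _ two_ne_zero] at h1
  · refine ContinuousOn.mul (by fun_prop) (ContinuousOn.rpow (by fun_prop) (by fun_prop) ?_)
    intro p _
    right; positivity
  · intro t s _ hs
    positivity
  · intro t s ht hs
    have e1 : 1 ≤ exp ((7 + I) * t) := one_le_exp (by positivity)
    have e2 : 1 ≤ s ^ (exp (-(2 / π * t)) / 2) := one_le_rpow hs (by positivity)
    have e3 := one_le_mul_of_one_le_of_one_le e1 e2
    simp only [mul_assoc]
    nlinarith
  · intro x y
    have := (le_abs_self _).trans (hA' x y)
    have e : (euclNorm (x - y) ^ 2) ^ (exp (-(2 / π * 0)) / 2) = euclNorm (x - y) := by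
      rw [mul_zero, neg_zero, exp_zero, ← sqrt_eq_rpow, sqrt_sq (euclNorm_nonneg _)]
    rwa [e, mul_zero, exp_zero, mul_one]
  · intro t ht x y hr hr1 σ hσ0 hσ
    have hs : 0 < σ 0 := by rw [hσ0]; positivity
    have dlin : ∀ b : ℝ, HasDerivAt (fun τ : ℝ => b * (t + τ)) b 0 := fun b => by
      simpa using ((hasDerivAt_id (0 : ℝ)).const_add t).const_mul b
    have d1 := (dlin (7 + I)).exp.const_mul A
    have d2 := ((dlin (2 / π)).neg.exp.div_const 2)
    have d3 := d1.mul (hσ.rpow d2 hs)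
    refine ⟨_, ?_, d3⟩
    simp only [Pi.neg_apply, add_zero]
    rw [rpow_sub_one hs.ne']
    set p := exp (-(2 / π * t)) / 2 with hp
    have hp0 : 0 < p := by positivity
    have hp1 : 2 * p ≤ 1 := by
      rw [hp, mul_div_cancel₀ _ two_ne_zero, exp_le_one_iff]
      have := mul_pos hc ht
      linarith
    have hb := abs_longIncr_le_log (h.integrable t ht.le) (h.abs_le_one t ht.le)
      (h.integral_abs_le t ht.le) hr hr1
    have hlog : log (σ 0) = -2 * log (1 / euclNorm (x - y)) := by
      rw [hσ0, log_pow, one_div, log_inv]; push_cast; ring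
    rw [← hσ0] at hb
    set φ := log (1 / euclNorm (x - y))
    set ℓ := longIncr (ω t) x y
    have hq : -(2 / π * φ + (7 + I)) ≤ ℓ / σ 0 := by
      rw [le_div_iff₀ hs]
      have := (abs_le.1 hb).1
      linarith
    have hmain : 0 ≤ (7 + I) + 2 * p * (ℓ / σ 0) + 2 / π * p * (2 * φ) := by
      have h2 := mul_le_mul_of_nonneg_left hq (by positivity : 0 ≤ 2 * p)
      have h3 := mul_le_mul_of_nonneg_right hp1 (by positivity : 0 ≤ 7 + I)
      linarith
    have hfac : 0 ≤ A * exp ((7 + I) * t) * σ 0 ^ p := by positivity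
    have := mul_nonneg hfac hmain
    rw [hlog]
    refine this.trans_eq ?_
    rw [hp]
    ring

/-- An integrated rate of strain controls the growth of the Lipschitz constant. -/
theorem IsEulerSolution.lipschitz_of_strain_le {I : ℝ} {ω : ℝ → ℝ × ℝ → ℝ}
    (h : IsEulerSolution I ω) {A : ℝ} (hA : 2 ≤ A)
    (hA' : ∀ x y, |ω 0 x - ω 0 y| ≤ A * euclNorm (x - y)) {Λ Λ' : ℝ → ℝ}
    (hΛ : ∀ t, HasDerivAt Λ (Λ' t) t) (hΛ0 : ∀ t, 0 ≤ t → 0 ≤ Λ t)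
    (hstrain : ∀ t, 0 < t → ∀ x y, 0 < euclNorm (x - y) → euclNorm (x - y) < 1 →
      |longIncr (ω t) x y| ≤ euclNorm (x - y) ^ 2 * Λ' t)
    {t : ℝ} (ht : 0 ≤ t) (x y : ℝ × ℝ) :
    |ω t x - ω t y| ≤ A * exp (Λ t) * euclNorm (x - y) := by
  have hΛc : Continuous Λ := continuous_iff_continuousAt.2 fun t => (hΛ t).continuousAt
  have h1 := h.abs_increment_le (F := fun t s => A * exp (Λ t) * √s) ?_ ?_ ?_ ?_ ?_ ht x y
  · rwa [sqrt_sq (euclNorm_nonneg _)] at h1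
  · exact Continuous.continuousOn (by fun_prop)
  · intro t s _ hs
    positivity
  · intro t s ht hs
    have e1 : 1 ≤ exp (Λ t) := one_le_exp (hΛ0 t ht)
    have e2 : 1 ≤ √s := one_le_sqrt.2 hs
    have e3 := one_le_mul_of_one_le_of_one_le e1 e2
    simp only [mul_assoc]
    nlinarith
  · intro x y
    have e1 : 1 ≤ exp (Λ 0) := one_le_exp (hΛ0 0 le_rfl)
    have e2 := (le_abs_self _).trans (hA' x y)
    rw [sqrt_sq (euclNorm_nonneg _)]
    have e3 : 0 ≤ A * euclNorm (x - y) := mul_nonneg (by linarith) (euclNorm_nonneg _)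
    nlinarith
  · intro t ht x y hr hr1 σ hσ0 hσ
    have hs : 0 < σ 0 := by rw [hσ0]; positivity
    have dΛ : HasDerivAt (fun τ : ℝ => Λ (t + τ)) (Λ' t) 0 := by
      have := HasDerivAt.comp_const_add t 0 (by simpa using hΛ t : HasDerivAt Λ (Λ' t) (t + 0))
      exact this
    refine ⟨_, ?_, (dΛ.exp.const_mul A).mul (hσ.sqrt hs.ne')⟩
    have hb := (abs_le.1 (hstrain t ht x y hr hr1)).1
    have hsq : √(σ 0) = euclNorm (x - y) := by rw [hσ0, sqrt_sq hr.le]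
    rw [hsq, add_zero]
    set r := euclNorm (x - y)
    have e : A * (exp (Λ t) * Λ' t) * r + A * exp (Λ t) * (2 * longIncr (ω t) x y / (2 * r))
        = A * exp (Λ t) * ((r ^ 2 * Λ' t + longIncr (ω t) x y) / r) := by
      field_simp
    rw [e]
    have : 0 ≤ r ^ 2 * Λ' t + longIncr (ω t) x y := by linarith
    positivity

/-- The maximal rate of strain of the flow grows at most like `(1 + t) exp (2 t / π)`. -/
theorem IsEulerSolution.strain_le {I : ℝ} {ω : ℝ → ℝ × ℝ → ℝ} (h : IsEulerSolution I ω)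
    (hI : 0 ≤ I) {A : ℝ} (hA : 2 ≤ A) (hA' : ∀ x y, |ω 0 x - ω 0 y| ≤ A * euclNorm (x - y))
    {t : ℝ} (ht : 0 ≤ t) {x y : ℝ × ℝ} (hr : 0 < euclNorm (x - y)) (hr1 : euclNorm (x - y) < 1) :
    |longIncr (ω t) x y| ≤ euclNorm (x - y) ^ 2 *
      ((7 + I + 4 + 4 * log A + 4 * (7 + I + 2 / π)) * (1 + t) * exp (2 / π * t)) := by
  have hc : 0 < 2 / π := by positivity
  have hc1 : 2 / π ≤ 4 := by
    rw [div_le_iff₀ pi_pos]; linarith [pi_gt_three]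
  have hπ4 := pi_le_four
  have hA0 : 0 < A := by linarith
  have hlogA : 0 ≤ log A := log_nonneg (by linarith)
  set c := 2 / π with hcdef
  set C := 7 + I with hC
  set E := exp (c * t) with hE
  have hE1 : 1 ≤ E := one_le_exp (by positivity)
  set α := exp (-(c * t)) with hα
  have hα0 : 0 < α := exp_pos _
  have hα1 : α ≤ 1 := exp_le_one_iff.2 (by have := mul_nonneg hc.le ht; linarith)
  have hEα : E = 1 / α := by rw [hα, exp_neg, one_div, inv_inv]
  set H := A * exp (C * t) with hH
  have hH2 : 2 ≤ H := by
    have : 1 ≤ exp (C * t) := one_le_exp (by positivity)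
    rw [hH]; nlinarith
  have hH0 : 0 < H := by linarith
  set R := (α / H) ^ (1 / α) with hR
  have hαH : 0 < α / H := by positivity
  have hαH1 : α / H < 1 := by rw [div_lt_one hH0]; linarith
  have hR0 : 0 < R := rpow_pos_of_pos hαH _
  have hR1 : R < 1 := rpow_lt_one hαH.le hαH1 (by positivity)
  have hRα : R ^ α = α / H := by
    rw [hR, ← rpow_mul hαH.le, one_div_mul_cancel hα0.ne', rpow_one]
  have hlogR : log (1 / R) = E * (log A + (C + c) * t) := by
    rw [one_div, log_inv, hR, log_rpow hαH, log_div hα0.ne' hH0.ne', hH,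
      log_mul hA0.ne' (exp_ne_zero _), log_exp, hα, log_exp, ← hα, hEα]
    ring
  have hlogR0 : 0 ≤ log (1 / R) := by
    rw [hlogR]; positivity
  have hfinal : C + 4 + 4 * log (1 / R) ≤
      (C + 4 + 4 * log A + 4 * (C + c)) * (1 + t) * E := by
    rw [hlogR]
    have e1 : C + 4 ≤ (C + 4) * (1 + t) * E := by
      have : 1 ≤ (1 + t) * E := one_le_mul_of_one_le_of_one_le (by linarith) hE1
      rw [mul_assoc]
      exact le_mul_of_one_le_right (by positivity) this
    have e2 : log A + (C + c) * t ≤ (log A + (C + c)) * (1 + t) := by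
      have := mul_nonneg hlogA ht
      have : 0 ≤ C + c := by positivity
      linarith
    have e3 := mul_le_mul_of_nonneg_left e2 (by positivity : 0 ≤ 4 * E)
    linarith
  have hmono : ∀ L, L ≤ C + 4 + 4 * log (1 / R) → |longIncr (ω t) x y| ≤
      euclNorm (x - y) ^ 2 * L → |longIncr (ω t) x y| ≤
      euclNorm (x - y) ^ 2 * ((C + 4 + 4 * log A + 4 * (C + c)) * (1 + t) * E) :=
    fun L hL hb => hb.trans (mul_le_mul_of_nonneg_left (hL.trans hfinal) (sq_nonneg _))
  rcases lt_or_ge (euclNorm (x - y)) R with hrR | hrR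
  · refine hmono _ ?_ (abs_longIncr_le_holder (h.integrable t ht) (h.abs_le_one t ht)
      (h.integral_abs_le t ht) hR1 hα0 hH0.le
      (fun z z' => h.holder hI hA hA' ht z z') hr hrR)
    rw [hRα, mul_div_cancel₀ _ hH0.ne', div_self hα0.ne']
    have := mul_le_mul_of_nonneg_right hπ4 hlogR0
    linarith
  · refine hmono _ ?_ (abs_longIncr_le_log (h.integrable t ht) (h.abs_le_one t ht)
      (h.integral_abs_le t ht) hr hr1)
    have e1 : log (1 / euclNorm (x - y)) ≤ log (1 / R) :=
      log_le_log (by positivity) (one_div_le_one_div_of_le hR0 hrR)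
    have e2 := mul_le_mul_of_nonneg_left e1 hc.le
    have e3 := mul_le_mul_of_nonneg_right hc1 hlogR0
    linarith

/-- Double exponential bound for the Lipschitz constant, with the rate `2 / π`. -/
theorem IsEulerSolution.lipschitz {I : ℝ} {ω : ℝ → ℝ × ℝ → ℝ} (h : IsEulerSolution I ω)
    (hI : 0 ≤ I) {A : ℝ} (hA : 2 ≤ A) (hA' : ∀ x y, |ω 0 x - ω 0 y| ≤ A * euclNorm (x - y)) :
    ∃ D, 0 ≤ D ∧ ∀ t, 0 ≤ t → ∀ x y,
      |ω t x - ω t y| ≤ A * exp (D * (1 + t) * exp (2 / π * t)) * euclNorm (x - y) := by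
  have hlogA : 0 ≤ log A := log_nonneg (by linarith)
  have hc : 0 < 2 / π := by positivity
  set B := 7 + I + 4 + 4 * log A + 4 * (7 + I + 2 / π) with hB
  have hB0 : 0 ≤ B := by positivity
  refine ⟨B / (2 / π), by positivity, fun t ht x y => ?_⟩
  refine h.lipschitz_of_strain_le hA hA'
    (Λ := fun t => B / (2 / π) * (1 + t) * exp (2 / π * t))
    (Λ' := fun t => B / (2 / π) * exp (2 / π * t) +
      B / (2 / π) * (1 + t) * (exp (2 / π * t) * (2 / π))) ?_ ?_ ?_ ht x y
  · intro t
    have d1 : HasDerivAt (fun t : ℝ => B / (2 / π) * (1 + t)) (B / (2 / π)) t := by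
      simpa using ((hasDerivAt_id t).const_add 1).const_mul (B / (2 / π))
    have d2 : HasDerivAt (fun t : ℝ => 2 / π * t) (2 / π) t := by
      simpa using (hasDerivAt_id t).const_mul (2 / π)
    exact d1.mul d2.exp
  · intro t ht
    positivity
  · intro t ht x y hr hr1
    refine (h.strain_le hI hA hA' ht.le hr hr1).trans
      (mul_le_mul_of_nonneg_left ?_ (sq_nonneg _))
    rw [← hB]
    have e : B / (2 / π) * (1 + t) * (exp (2 / π * t) * (2 / π)) =
        B * (1 + t) * exp (2 / π * t) := by
      field_simp
    rw [e]
    have : 0 ≤ B / (2 / π) * exp (2 / π * t) := by positivity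
    linarith

lemma euclNorm_le_two_mul_norm (v : ℝ × ℝ) : euclNorm v ≤ 2 * ‖v‖ := by
  unfold euclNorm
  refine Real.sqrt_le_iff.2 ⟨by positivity, ?_⟩
  have h1 := sq_le_sq' (by linarith [neg_abs_le v.1, norm_fst_le v, Real.norm_eq_abs v.1])
    ((le_abs_self v.1).trans (norm_fst_le v))
  have h2 := sq_le_sq' (by linarith [neg_abs_le v.2, norm_snd_le v, Real.norm_eq_abs v.2])
    ((le_abs_self v.2).trans (norm_snd_le v))
  nlinarith [sq_nonneg ‖v‖]

lemma norm_le_euclNorm (v : ℝ × ℝ) : ‖v‖ ≤ euclNorm v :=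
  max_le (Real.abs_le_sqrt (by nlinarith [sq_nonneg v.2]))
    (Real.abs_le_sqrt (by nlinarith [sq_nonneg v.1]))

lemma gradSup_le {f : ℝ × ℝ → ℝ} {L : ℝ} (hL : 0 ≤ L)
    (hf : ∀ x y, |f x - f y| ≤ L * euclNorm (x - y)) : gradSup f ≤ 2 * L := by
  refine ciSup_le fun x => norm_fderiv_le_of_lip' ℝ (by positivity)
    (Eventually.of_forall fun y => ?_)
  have := mul_le_mul_of_nonneg_left (euclNorm_le_two_mul_norm (y - x)) hL
  rw [Real.norm_eq_abs]
  linarith [hf y x]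

lemma tendsto_log_add_log_div_add (E c : ℝ) :
    Tendsto (fun t : ℝ => (log E + log (1 + t)) / t + c) atTop (nhds c) := by
  have h1 : Tendsto (fun t : ℝ => log E / t) atTop (nhds 0) := tendsto_const_nhds.div_atTop tendsto_id
  have h2 : Tendsto (fun t : ℝ => log (1 + t) / t) atTop (nhds 0) := by
    have h3 : Tendsto (fun t : ℝ => log (1 + t) / (1 * (1 + t) + (-1))) atTop (nhds 0) := by
      have := (tendsto_pow_log_div_mul_add_atTop 1 (-1) 1 one_ne_zero).comp
        (tendsto_atTop_add_const_left atTop (1 : ℝ) tendsto_id)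
      simpa [Function.comp_def] using this
    refine h3.congr fun t => ?_
    congr 1; ring
  have := (h1.add h2).add_const c
  simp only [add_zero, zero_add] at this
  refine this.congr fun t => ?_
  rw [add_div]

lemma limsup_log_log_div_le {g : ℝ → ℝ} {A D c : ℝ} (hA : 1 ≤ A) (hD : 0 ≤ D) (hc : 0 ≤ c)
    (hg : ∀ t, 0 ≤ t → g t ≤ A * exp (D * (1 + t) * exp (c * t))) :
    limsup (fun t : ℝ => log (log (max (g t) (exp 1))) / t) atTop ≤ c := by
  have hA0 : 0 < A := by linarith
  have hlogA : 0 ≤ log A := log_nonneg hA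
  set E := log A + 1 + D with hE
  have hE0 : 0 < E := by positivity
  have hlog1 : ∀ t, 1 ≤ log (max (g t) (exp 1)) := fun t => by
    rw [le_log_iff_exp_le (lt_of_lt_of_le (exp_pos 1) (le_max_right _ _))]
    exact le_max_right _ _
  have hlim := tendsto_log_add_log_div_add E c
  refine (limsup_le_limsup ?_ ?_ hlim.isBoundedUnder_le).trans_eq hlim.limsup_eq
  · filter_upwards [eventually_gt_atTop 0] with t ht
    have e0 : 1 ≤ (1 + t) * exp (c * t) :=
      one_le_mul_of_one_le_of_one_le (by linarith) (one_le_exp (by positivity))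
    have e1 : max (g t) (exp 1) ≤ exp (log A + 1 + D * (1 + t) * exp (c * t)) := by
      have hp : 0 ≤ D * (1 + t) * exp (c * t) := by positivity
      refine max_le ((hg t ht.le).trans ?_) (exp_le_exp.2 (by linarith))
      rw [← exp_log hA0, ← exp_add, exp_le_exp, log_exp]
      linarith
    have e2 : log (max (g t) (exp 1)) ≤ E * ((1 + t) * exp (c * t)) := by
      have := log_le_log (lt_of_lt_of_le (exp_pos 1) (le_max_right _ _)) e1
      rw [log_exp] at this
      have := mul_le_mul_of_nonneg_left e0 (by positivity : 0 ≤ log A + 1)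
      rw [hE]
      linarith
    have e3 := log_le_log (by linarith [hlog1 t]) e2
    rw [log_mul hE0.ne' (by positivity), log_mul (by positivity) (exp_ne_zero _), log_exp] at e3
    rw [div_add' _ _ _ ht.ne']
    exact div_le_div_of_nonneg_right (by linarith) ht.le
  · refine IsBoundedUnder.isCoboundedUnder_le ⟨0, ?_⟩
    rw [eventually_map]
    filter_upwards [eventually_gt_atTop 0] with t ht
    exact div_nonneg (log_nonneg (hlog1 t)) ht.le

theorem statement2 (I : ℝ) (hI : 1 ≤ I) (ω : ℝ → ℝ × ℝ → ℝ)
    -- ω is continuously differentiable on [0,∞) × ℝ²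
    (hC1 : ContDiffOn ℝ 1 (Function.uncurry ω) (Ici (0 : ℝ) ×ˢ (univ : Set (ℝ × ℝ))))
    -- for every t ≥ 0, ω(t,·) ∈ L¹ ∩ W^{1,∞} is odd in x₂,
    -- with ‖ω(t,·)‖_{L^∞} ≤ 1 and ‖ω(t,·)‖_{L¹} ≤ I
    (hreg : ∀ t : ℝ, 0 ≤ t →
      Integrable (ω t) (volume : Measure (ℝ × ℝ)) ∧
      (∃ K : ℝ≥0, LipschitzWith K (ω t)) ∧
      (∀ x : ℝ × ℝ, ω t (x.1, -x.2) = -ω t x) ∧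
      (∀ x : ℝ × ℝ, |ω t x| ≤ 1) ∧
      (∫ y : ℝ × ℝ, |ω t y|) ≤ I)
    -- the transport (Euler vorticity) equation ∂_t ω + u·∇ω = 0
    (heq : ∀ t : ℝ, 0 ≤ t → ∀ x : ℝ × ℝ,
      derivWithin (fun τ => ω τ x) (Ici (0 : ℝ)) t
        + (biotSavart (ω t) x).1 * fderiv ℝ (ω t) x (1, 0)
        + (biotSavart (ω t) x).2 * fderiv ℝ (ω t) x (0, 1) = 0) :
    -- conclusion: limsup_{t→∞} (ln ln max{‖∇ω(t,·)‖_{L^∞}, e}) / t ≤ 2/π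
    Filter.limsup
        (fun t : ℝ => Real.log (Real.log (max (gradSup (ω t)) (Real.exp 1))) / t)
        atTop
      ≤ 2 / π := by
  have h : IsEulerSolution I ω :=
    ⟨hC1, fun t ht => (hreg t ht).1, fun t ht => (hreg t ht).2.2.2.1,
      fun t ht => (hreg t ht).2.2.2.2, heq⟩
  obtain ⟨K, hK⟩ := (hreg 0 le_rfl).2.1
  have hA : ∀ x y, |ω 0 x - ω 0 y| ≤ (2 + K) * euclNorm (x - y) := fun x y => by
    have h1 := hK.dist_le_mul x y
    rw [Real.dist_eq, dist_eq_norm] at h1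
    have h2 := mul_le_mul_of_nonneg_left (norm_le_euclNorm (x - y)) K.coe_nonneg
    linarith [euclNorm_nonneg (x - y)]
  have hK0 : (0 : ℝ) ≤ K := K.coe_nonneg
  obtain ⟨D, hD, hlip⟩ := h.lipschitz (by linarith) (by linarith) hA
  refine limsup_log_log_div_le (A := 2 * (2 + K)) (by linarith) hD (by positivity) fun t ht => ?_
  rw [mul_assoc]
  exact gradSup_le (by positivity) (hlip t ht)
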